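/- arXiv:2205.08800 — 2 statements merged into one kernel-verified Lean document; each statement's English description precedes it below -/
import Mathlib

section
/- Fix κ ∈ (4,8) and N ≥ 1. The function G^{(N)} is smooth on 𝔛_{2N} and satisfies, for every j ∈ {1,…,2N}, the BPZ partial differential equation (κ/2)·∂²G^{(N)}/∂x_j²(x) + ∑_{i≠j} [ (2/(x_i−x_j))·∂G^{(N)}/∂x_i(x) − (2h(κ)/(x_i−x_j)²)·G^{(N)}(x) ] = 0 for all x ∈ 𝔛_{2N}. -/
open Filter Topology MeasureTheory

noncomputable section

/-- The conformal weight `h(κ) = (6-κ)/(2κ)`. -/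
def hexp (κ : ℝ) : ℝ := (6 - κ) / (2 * κ)

/-- The cluster weight `q(κ) = 4 cos²(4π/κ)`. -/
def qexp (κ : ℝ) : ℝ := 4 * Real.cos (4 * Real.pi / κ) ^ 2

/-- The normalizing constant `c(κ) = √(q(κ)) Γ(2-8/κ) / Γ(1-4/κ)²`. -/
def cgConst (κ : ℝ) : ℝ :=
  Real.sqrt (qexp κ) * Real.Gamma (2 - 8 / κ) / Real.Gamma (1 - 4 / κ) ^ 2

/-- The index of `x_{2r-1}` (1-indexed), i.e. `2r` (0-indexed). -/
def idxA (N : ℕ) (r : Fin N) : Fin (2 * N) := ⟨2 * r.val, by have := r.isLt; omega⟩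

/-- The index of `x_{2r}` (1-indexed), i.e. `2r+1` (0-indexed). -/
def idxB (N : ℕ) (r : Fin N) : Fin (2 * N) := ⟨2 * r.val + 1, by have := r.isLt; omega⟩

/-- The Coulomb gas integrand
`∏_{r<s} (u_s-u_r)^{8/κ} ∏_{r,i} |u_r - x_i|^{-4/κ}`. -/
def cgIntegrand (κ : ℝ) (N : ℕ) (x : Fin (2 * N) → ℝ) (u : Fin N → ℝ) : ℝ :=
  (∏ r : Fin N, ∏ s : Fin N, if r < s then (u s - u r) ^ (8 / κ) else 1) *
    ∏ r : Fin N, ∏ i : Fin (2 * N), |u r - x i| ^ (-(4 / κ))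

/-- The integration domain: the open box `∏_r (x_{2r-1}, x_{2r})`. -/
def cgBox (N : ℕ) (x : Fin (2 * N) → ℝ) : Set (Fin N → ℝ) :=
  Set.univ.pi fun r => Set.Ioo (x (idxA N r)) (x (idxB N r))

/-- The Coulomb gas integral `G^{(N)}` associated to the completely unnested
link pattern `⌢⌢^{(N)} = {{1,2},…,{2N-1,2N}}`. -/
def cgG (κ : ℝ) (N : ℕ) (x : Fin (2 * N) → ℝ) : ℝ :=
  cgConst κ ^ N
    * (∏ i : Fin (2 * N), ∏ k : Fin (2 * N), if i < k then (x k - x i) ^ (2 / κ) else 1)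
    * ∫ u in cgBox N x, cgIntegrand κ N x u

/-- Partial derivative of `F` in the `i`-th coordinate at `x`. -/
def pd (n : ℕ) (F : (Fin n → ℝ) → ℝ) (i : Fin n) (x : Fin n → ℝ) : ℝ :=
  deriv (fun t => F (Function.update x i t)) (x i)

/-- The chamber `𝔛_n = {x ∈ ℝⁿ : x₀ < x₁ < ⋯ < x_{n-1}}`. -/
def chamber (n : ℕ) : Set (Fin n → ℝ) := {x | StrictMono x}

theorem integrable_of_continuousOn_compact {T E : Type*} [TopologicalSpace T] [T2Space T]
    [MeasurableSpace T] [OpensMeasurableSpace T] [NormedAddCommGroup E] {μ : Measure T}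
    [IsFiniteMeasure μ] {K : Set T} (hK : IsCompact K) (hμ : μ.restrict K = μ) {g : T → E} (hg : ContinuousOn g K) :
    Integrable g μ := by
  have := hg.integrableOn_compact (μ := μ) hK
  rwa [IntegrableOn, hμ] at this

section Parametric

variable {P T E : Type} [NormedAddCommGroup P] [NormedSpace ℝ P] [NormedAddCommGroup T]
  [NormedSpace ℝ T] [NormedAddCommGroup E] [NormedSpace ℝ E]

/-- The partial Fréchet derivative of `f` in its first variable. -/
def fderivFst (f : P × T → E) (q : P × T) : P →L[ℝ] E :=
  (fderiv ℝ f q).comp (ContinuousLinearMap.inl ℝ P T)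

theorem ContDiffAt.fderivFst {f : P × T → E} {q : P × T} (hf : ContDiffAt ℝ (⊤ : ℕ∞) f q) :
    ContDiffAt ℝ (⊤ : ℕ∞) (_root_.fderivFst f) q :=
  (hf.fderiv_right (m := (⊤ : ℕ∞)) le_rfl).clm_comp contDiffAt_const

variable [FiniteDimensional ℝ P] [MeasurableSpace T] [BorelSpace T]

/-- Differentiation under the integral sign over a finite measure carried by a compact set. -/
theorem hasFDerivAt_integral_of_contDiffAt {μ : Measure T} [IsFiniteMeasure μ] {K : Set T}
    (hK : IsCompact K) (hμ : μ.restrict K = μ) {s : Set P} (hs : IsOpen s) {f : P × T → E}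
    (hf : ∀ x ∈ s, ∀ t ∈ K, ContDiffAt ℝ (⊤ : ℕ∞) f (x, t)) {x : P} (hx : x ∈ s) :
    HasFDerivAt (fun x => ∫ t, f (x, t) ∂μ) (∫ t, fderivFst f (x, t) ∂μ) x := by
  have hcont : ∀ {F : Type} [NormedAddCommGroup F] [NormedSpace ℝ F] {g : P × T → F},
      (∀ x ∈ s, ∀ t ∈ K, ContDiffAt ℝ (⊤ : ℕ∞) g (x, t)) → ∀ x ∈ s,
        ContinuousOn (fun t => g (x, t)) K := by
    intro F _ _ g hg x hx t ht
    exact ((hg x hx t ht).continuousAt.comp (f := fun t => (x, t))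
      (by fun_prop)).continuousWithinAt
  have hf' : ∀ x ∈ s, ∀ t ∈ K, ContDiffAt ℝ (⊤ : ℕ∞) (fderivFst f) (x, t) :=
    fun x hx t ht => (hf x hx t ht).fderivFst
  obtain ⟨ε, hε, hεs⟩ := Metric.isOpen_iff.1 hs x hx
  have hball : Metric.closedBall x (ε / 2) ⊆ s :=
    (Metric.closedBall_subset_ball (by linarith)).trans hεs
  have hcomp : IsCompact (Metric.closedBall x (ε / 2) ×ˢ K) :=
    (isCompact_closedBall x (ε / 2)).prod hK
  obtain ⟨C, hC⟩ := hcomp.exists_bound_of_continuousOn (f := fderivFst f)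
    (fun q hq => (hf' q.1 (hball hq.1) q.2 hq.2).continuousAt.continuousWithinAt)
  have hae : ∀ᵐ t ∂μ, t ∈ K := by
    rw [← hμ]; exact ae_restrict_mem hK.measurableSet
  refine hasFDerivAt_integral_of_dominated_of_fderiv_le (𝕜 := ℝ)
    (F := fun x t => f (x, t)) (F' := fun x t => fderivFst f (x, t)) (bound := fun _ => C)
    (Metric.closedBall_mem_nhds x (half_pos hε)) ?_ ?_ ?_ ?_ (integrable_const C) ?_
  · filter_upwards [hs.mem_nhds hx] with y hy
    exact (integrable_of_continuousOn_compact hK hμ (hcont hf y hy)).1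
  · exact integrable_of_continuousOn_compact hK hμ (hcont hf x hx)
  · exact (integrable_of_continuousOn_compact hK hμ (hcont hf' x hx)).1
  · filter_upwards [hae] with t ht y hy
    exact hC (y, t) ⟨hy, ht⟩
  · filter_upwards [hae] with t ht y hy
    have h1 := ((hf y (hball hy) t ht).differentiableAt (by simp)).hasFDerivAt
    have h2 : HasFDerivAt (fun y : P => (y, t)) (ContinuousLinearMap.inl ℝ P T) y :=
      hasFDerivAt_prodMk_left y t
    exact h1.comp y h2

theorem contDiffOn_integral_of_contDiffAt {μ : Measure T} [IsFiniteMeasure μ] {K : Set T}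
    (hK : IsCompact K) (hμ : μ.restrict K = μ) {s : Set P} (hs : IsOpen s) {f : P × T → E}
    (hf : ∀ x ∈ s, ∀ t ∈ K, ContDiffAt ℝ (⊤ : ℕ∞) f (x, t)) :
    ContDiffOn ℝ (⊤ : ℕ∞) (fun x => ∫ t, f (x, t) ∂μ) s := by
  suffices H : ∀ n : ℕ, ∀ {F : Type} [NormedAddCommGroup F] [NormedSpace ℝ F] {g : P × T → F},
      (∀ x ∈ s, ∀ t ∈ K, ContDiffAt ℝ (⊤ : ℕ∞) g (x, t)) →
        ContDiffOn ℝ n (fun x => ∫ t, g (x, t) ∂μ) s from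
    contDiffOn_infty.2 fun n => H n hf
  intro n
  induction n with
  | zero =>
    intro F _ _ g hg
    exact contDiffOn_zero.2 fun x hx =>
      (hasFDerivAt_integral_of_contDiffAt hK hμ hs hg hx).continuousAt.continuousWithinAt
  | succ n ih =>
    intro F _ _ g hg
    have hd := fun x hx => hasFDerivAt_integral_of_contDiffAt hK hμ hs hg (x := x) hx
    rw [Nat.cast_add, Nat.cast_one, contDiffOn_succ_iff_fderiv_of_isOpen hs]
    refine ⟨fun x hx => (hd x hx).differentiableAt.differentiableWithinAt, by simp, ?_⟩
    exact (ih (fun x hx t ht => (hg x hx t ht).fderivFst)).congr fun x hx => (hd x hx).fderiv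

end Parametric

section BetaMeasure

theorem integrable_mul_one_sub_rpow {p : ℝ} (hp : -1 < p) :
    IntegrableOn (fun t : ℝ => (t * (1 - t)) ^ p) (Set.Ioo 0 1) := by
  have h := (Complex.betaIntegral_convergent (u := (p + 1 : ℝ)) (v := (p + 1 : ℝ))
    (by rw [Complex.ofReal_re]; linarith) (by rw [Complex.ofReal_re]; linarith)).norm
  rw [intervalIntegrable_iff_integrableOn_Ioo_of_le zero_le_one] at h
  refine h.congr_fun (fun t ht => ?_) measurableSet_Ioo
  have h0 : (0 : ℝ) < t := ht.1
  have h1 : (0 : ℝ) < 1 - t := sub_pos.2 ht.2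
  have e : ((1 : ℂ) - t) = ((1 - t : ℝ) : ℂ) := by push_cast; rfl
  simp only [norm_mul]
  rw [e, Complex.norm_cpow_eq_rpow_re_of_pos h0, Complex.norm_cpow_eq_rpow_re_of_pos h1,
    Real.mul_rpow h0.le h1.le]
  simp

/-- Integration by parts against the weight `(τ (1 - τ)) ^ p` on the unit interval. -/
theorem integral_weight_mul_eq_zero {p : ℝ} (hp : -1 < p) {m m' : ℝ → ℝ}
    (hm : ∀ τ ∈ Set.Icc (0 : ℝ) 1, HasDerivAt m (m' τ) τ)
    (hm' : ContinuousOn m' (Set.Icc 0 1)) :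
    ∫ τ in Set.Ioo (0 : ℝ) 1,
      (τ * (1 - τ)) ^ p * ((1 + p) * (1 - 2 * τ) * m τ + τ * (1 - τ) * m' τ) = 0 := by
  have hmc : ContinuousOn m (Set.Icc 0 1) := fun τ hτ => (hm τ hτ).continuousAt.continuousWithinAt
  have hg : ContinuousOn (fun τ => (1 + p) * (1 - 2 * τ) * m τ + τ * (1 - τ) * m' τ)
      (Set.Icc (0 : ℝ) 1) := by fun_prop
  obtain ⟨C, hC⟩ := isCompact_Icc.exists_bound_of_continuousOn hg
  have h_int : IntervalIntegrable (fun τ => (τ * (1 - τ)) ^ p *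
      ((1 + p) * (1 - 2 * τ) * m τ + τ * (1 - τ) * m' τ)) volume 0 1 := by
    rw [intervalIntegrable_iff_integrableOn_Ioo_of_le zero_le_one]
    refine Integrable.mul_bdd (c := C) (integrable_mul_one_sub_rpow hp)
      ((hg.mono Set.Ioo_subset_Icc_self).aestronglyMeasurable measurableSet_Ioo) ?_
    filter_upwards [ae_restrict_mem measurableSet_Ioo] with τ hτ
    exact hC τ (Set.Ioo_subset_Icc_self hτ)
  have hcont : ContinuousOn (fun τ => (τ * (1 - τ)) ^ (1 + p) * m τ) (Set.Icc (0 : ℝ) 1) := by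
    refine ContinuousOn.mul (ContinuousOn.rpow_const (by fun_prop) fun _ _ => Or.inr ?_) hmc
    linarith
  have hder : ∀ τ ∈ Set.Ioo (0 : ℝ) 1, HasDerivAt (fun τ => (τ * (1 - τ)) ^ (1 + p) * m τ)
      ((τ * (1 - τ)) ^ p * ((1 + p) * (1 - 2 * τ) * m τ + τ * (1 - τ) * m' τ)) τ := by
    intro τ hτ
    have hpos : 0 < τ * (1 - τ) := mul_pos hτ.1 (sub_pos.2 hτ.2)
    have h1 : HasDerivAt (fun τ : ℝ => τ * (1 - τ)) (1 * (1 - τ) + τ * (-1)) τ :=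
      (hasDerivAt_id τ).mul ((hasDerivAt_id τ).const_sub 1)
    have h2 := (h1.rpow_const (p := 1 + p) (Or.inl hpos.ne')).mul
      (hm τ (Set.Ioo_subset_Icc_self hτ))
    convert! h2 using 1
    rw [show 1 + p - 1 = p by ring, Real.rpow_add hpos, Real.rpow_one]
    ring
  have := intervalIntegral.integral_eq_sub_of_hasDerivAt_of_le zero_le_one hcont hder h_int
  rw [intervalIntegral.integral_of_le zero_le_one, integral_Ioc_eq_integral_Ioo] at this
  rw [this]
  have hne : 1 + p ≠ 0 := by linarith
  simp [Real.zero_rpow hne]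

variable {N : ℕ}

/-- The closed unit cube. -/
def unitCube (N : ℕ) : Set (Fin N → ℝ) := Set.univ.pi fun _ => Set.Icc 0 1

/-- The open unit cube. -/
def openCube (N : ℕ) : Set (Fin N → ℝ) := Set.univ.pi fun _ => Set.Ioo 0 1

/-- The product of symmetric beta weights. -/
def betaWeight (p : ℝ) (t : Fin N → ℝ) : ℝ := ∏ r, (t r * (1 - t r)) ^ p

/-- The product of (unnormalized) symmetric beta distributions on the unit cube. -/
def betaMeasure (N : ℕ) (p : ℝ) : Measure (Fin N → ℝ) :=
  (volume.restrict (openCube N)).withDensity fun t => ENNReal.ofReal (betaWeight p t)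

theorem openCube_subset_unitCube : openCube N ⊆ unitCube N :=
  Set.pi_mono fun _ _ => Set.Ioo_subset_Icc_self

theorem measurableSet_openCube : MeasurableSet (openCube N) :=
  MeasurableSet.univ_pi fun _ => measurableSet_Ioo

theorem isCompact_unitCube : IsCompact (unitCube N) :=
  isCompact_univ_pi fun _ => isCompact_Icc

theorem measurable_betaWeight (p : ℝ) : Measurable (betaWeight (N := N) p) := by
  unfold betaWeight
  fun_prop

theorem betaWeight_nonneg (p : ℝ) {t : Fin N → ℝ} (ht : t ∈ openCube N) : 0 ≤ betaWeight p t :=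
  Finset.prod_nonneg fun r _ => Real.rpow_nonneg
    (mul_nonneg (ht r trivial).1.le (sub_nonneg.2 (ht r trivial).2.le)) _

theorem volume_restrict_openCube :
    (volume : Measure (Fin N → ℝ)).restrict (openCube N)
      = Measure.pi fun _ => volume.restrict (Set.Ioo 0 1) := by
  rw [openCube, volume_pi, Measure.restrict_pi_pi]

theorem isFiniteMeasure_betaMeasure {p : ℝ} (hp : -1 < p) :
    IsFiniteMeasure (betaMeasure N p) := by
  have h : Integrable (betaWeight (N := N) p) (volume.restrict (openCube N)) := by
    rw [volume_restrict_openCube]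
    exact Integrable.fintype_prod (f := fun _ : Fin N => fun t : ℝ => (t * (1 - t)) ^ p)
      fun _ => integrable_mul_one_sub_rpow hp
  exact isFiniteMeasure_withDensity_ofReal h.2

theorem ae_betaMeasure_mem_openCube (p : ℝ) : ∀ᵐ t ∂betaMeasure N p, t ∈ openCube N :=
  (withDensity_absolutelyContinuous _ _).ae_le (ae_restrict_mem measurableSet_openCube)

theorem betaMeasure_restrict_unitCube (p : ℝ) :
    (betaMeasure N p).restrict (unitCube N) = betaMeasure N p :=
  Measure.restrict_eq_self_of_ae_mem <|
    (ae_betaMeasure_mem_openCube p).mono fun _ h => openCube_subset_unitCube h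

theorem integral_betaMeasure (p : ℝ) (g : (Fin N → ℝ) → ℝ) :
    ∫ t, g t ∂betaMeasure N p = ∫ t in openCube N, betaWeight p t * g t := by
  rw [betaMeasure, integral_withDensity_eq_integral_toReal_smul
    (measurable_betaWeight p).ennreal_ofReal (ae_of_all _ fun _ => ENNReal.ofReal_lt_top)]
  refine setIntegral_congr_fun measurableSet_openCube fun t ht => ?_
  simp only [ENNReal.toReal_ofReal (betaWeight_nonneg p ht), smul_eq_mul]

theorem betaMeasure_integral_by_parts {p : ℝ} (hp : -1 < p) (s : Fin N) {M : (Fin N → ℝ) → ℝ}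
    (hM : ∀ t ∈ unitCube N, ContDiffAt ℝ (⊤ : ℕ∞) M t) :
    ∫ t, ((1 + p) * (1 - 2 * t s) * M t + t s * (1 - t s) * fderiv ℝ M t (Pi.single s 1))
      ∂betaMeasure N p = 0 := by
  have := isFiniteMeasure_betaMeasure (N := N) hp
  have hMc : ContinuousOn M (unitCube N) := fun t ht => (hM t ht).continuousAt.continuousWithinAt
  have hMd : ContinuousOn (fun t => fderiv ℝ M t (Pi.single s 1)) (unitCube N) := fun t ht =>
    (((hM t ht).fderiv_right (m := (⊤ : ℕ∞)) le_rfl).clm_apply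
      contDiffAt_const).continuousAt.continuousWithinAt
  set g : (Fin N → ℝ) → ℝ := fun t =>
    (1 + p) * (1 - 2 * t s) * M t + t s * (1 - t s) * fderiv ℝ M t (Pi.single s 1) with hg
  have hgc : ContinuousOn g (unitCube N) := by fun_prop
  have hgi : Integrable g (betaMeasure N p) :=
    integrable_of_continuousOn_compact isCompact_unitCube (betaMeasure_restrict_unitCube p) hgc
  have hwi : Integrable (fun t => betaWeight p t * g t) (volume.restrict (openCube N)) := by
    rw [betaMeasure, integrable_withDensity_iff_integrable_smul'
      (measurable_betaWeight p).ennreal_ofReal (ae_of_all _ fun _ => ENNReal.ofReal_lt_top)] at hgi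
    refine hgi.congr ?_
    filter_upwards [ae_restrict_mem measurableSet_openCube] with t ht
    simp only [ENNReal.toReal_ofReal (betaWeight_nonneg p ht), smul_eq_mul]
  rw [integral_betaMeasure]
  obtain ⟨n, rfl⟩ : ∃ n, N = n + 1 := ⟨N - 1, by have := s.isLt; omega⟩
  rw [volume_restrict_openCube] at hwi ⊢
  have hmp := (measurePreserving_piFinSuccAbove
    (fun _ : Fin (n + 1) => (volume : Measure ℝ).restrict (Set.Ioo 0 1)) s).symm
  rw [← hmp.integral_comp', integral_prod_symm]
  · refine integral_eq_zero_of_ae ?_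
    have hae : ∀ᵐ y ∂(Measure.pi fun _ : Fin n => (volume : Measure ℝ).restrict (Set.Ioo 0 1)),
        y ∈ openCube n := by
      rw [← volume_restrict_openCube]
      exact ae_restrict_mem measurableSet_openCube
    filter_upwards [hae] with y hy
    have hmem : ∀ τ ∈ Set.Icc (0 : ℝ) 1, s.insertNth τ y ∈ unitCube (n + 1) := by
      intro τ hτ i _
      refine Fin.succAboveCases s ?_ (fun k => ?_) i
      · simpa using hτ
      · simpa using Set.Ioo_subset_Icc_self (hy k trivial)
    have hins : ∀ τ : ℝ, HasDerivAt (fun τ : ℝ => (s.insertNth τ y : Fin (n + 1) → ℝ))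
        (Pi.single s 1) τ := by
      intro τ
      rw [hasDerivAt_pi]
      intro i
      refine Fin.succAboveCases s ?_ (fun k => ?_) i
      · simpa using hasDerivAt_id' τ
      · simpa [Fin.succAbove_ne] using hasDerivAt_const τ (y k)
    have hcins : Continuous fun τ : ℝ => (s.insertNth τ y : Fin (n + 1) → ℝ) :=
      continuous_iff_continuousAt.2 fun τ => (hins τ).continuousAt
    have key := integral_weight_mul_eq_zero hp (m := fun τ => M (s.insertNth τ y))
      (m' := fun τ => fderiv ℝ M (s.insertNth τ y) (Pi.single s 1))
      (fun τ hτ => by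
        have hd := ((hM _ (hmem τ hτ)).differentiableAt (by simp)).hasFDerivAt
        exact hd.comp_hasDerivAt τ (hins τ))
      (hMd.comp hcins.continuousOn hmem)
    have hE : ∀ τ : ℝ, (MeasurableEquiv.piFinSuccAbove (fun _ : Fin (n + 1) => ℝ) s).symm (τ, y)
        = s.insertNth τ y := fun τ => rfl
    simp only [hE, betaWeight, Fin.prod_univ_succAbove _ s, Fin.insertNth_apply_same,
      Fin.insertNth_apply_succAbove, Pi.zero_apply]
    refine Eq.trans ?_ ((congrArg ((∏ i, (y i * (1 - y i)) ^ p) * ·) key).trans (mul_zero _))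
    rw [← integral_const_mul]
    refine integral_congr_ae (ae_of_all _ fun τ => ?_)
    simp only
    ring
  · exact (hmp.integrable_comp_emb (MeasurableEquiv.measurableEmbedding _)).2 hwi

end BetaMeasure

section Coulomb

variable {ι : Type*}

/-- The interaction coefficients in the Hessian of `coulombLog`. -/
def coulombHess (κ : ℝ) (σ z : ι → ℝ) (α β : ι) : ℝ :=
  2 / κ * (σ α * σ β) / (z α - z β) ^ 2

theorem coulombHess_comm (κ : ℝ) (σ z : ι → ℝ) (α β : ι) :
    coulombHess κ σ z α β = coulombHess κ σ z β α := by
  rw [coulombHess, coulombHess, mul_comm (σ α), ← neg_sub, neg_sq]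

theorem coulombHess_self (κ : ℝ) (σ z : ι → ℝ) (α : ι) : coulombHess κ σ z α α = 0 := by
  simp [coulombHess]

variable [Fintype ι]

/-- The logarithm of the Coulomb gas correlation of charges `σ` placed at `z`. -/
def coulombLog (κ : ℝ) (σ z : ι → ℝ) : ℝ :=
  1 / κ * ∑ α, ∑ β, σ α * σ β * Real.log (z α - z β)

/-- The partial derivative of `coulombLog` with respect to the position `z α`. -/
def coulombForce (κ : ℝ) (σ z : ι → ℝ) (α : ι) : ℝ :=
  2 / κ * σ α * ∑ β, σ β / (z α - z β)

theorem hasDerivAt_coulombLog (κ : ℝ) (σ : ι → ℝ) {z : ℝ → ι → ℝ} {v : ι → ℝ} {τ : ℝ}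
    (hz : ∀ α, HasDerivAt (fun τ => z τ α) (v α) τ) (hinj : Function.Injective (z τ)) :
    HasDerivAt (fun τ => coulombLog κ σ (z τ)) (∑ α, v α * coulombForce κ σ (z τ) α) τ := by
  have h1 : HasDerivAt (fun τ => coulombLog κ σ (z τ))
      (1 / κ * ∑ α, ∑ β, σ α * σ β * ((v α - v β) / (z τ α - z τ β))) τ := by
    refine HasDerivAt.const_mul _ (HasDerivAt.fun_sum fun α _ => HasDerivAt.fun_sum fun β _ => ?_)
    refine HasDerivAt.const_mul _ ?_
    by_cases h : α = β
    · subst h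
      simpa using hasDerivAt_const τ (0 : ℝ)
    · exact ((hz α).sub (hz β)).log (sub_ne_zero.2 (hinj.ne h))
  convert! h1 using 1
  have h2 : ∑ α, ∑ β, σ α * σ β * ((v α - v β) / (z τ α - z τ β))
      = ∑ α, ∑ β, σ α * σ β * (v α / (z τ α - z τ β))
        + ∑ α, ∑ β, σ α * σ β * (v α / (z τ α - z τ β)) := by
    conv_rhs => rw [add_comm]; enter [1]; rw [Finset.sum_comm]
    rw [← Finset.sum_add_distrib]
    refine Finset.sum_congr rfl fun α _ => ?_
    rw [← Finset.sum_add_distrib]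
    refine Finset.sum_congr rfl fun β _ => ?_
    rw [← neg_sub (z τ α) (z τ β), div_neg, sub_div]
    ring
  rw [h2, ← two_mul, ← mul_assoc, Finset.mul_sum]
  refine Finset.sum_congr rfl fun α _ => ?_
  rw [coulombForce, Finset.mul_sum, Finset.mul_sum, Finset.mul_sum]
  refine Finset.sum_congr rfl fun β _ => ?_
  ring

theorem hasDerivAt_coulombForce (κ : ℝ) (σ : ι → ℝ) {z : ℝ → ι → ℝ} {v : ι → ℝ} {τ : ℝ}
    (hz : ∀ α, HasDerivAt (fun τ => z τ α) (v α) τ) (hinj : Function.Injective (z τ)) (α : ι) :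
    HasDerivAt (fun τ => coulombForce κ σ (z τ) α)
      (∑ β, coulombHess κ σ (z τ) α β * (v β - v α)) τ := by
  have h1 : HasDerivAt (fun τ => coulombForce κ σ (z τ) α)
      (2 / κ * σ α * ∑ β, -(σ β * (v α - v β)) / (z τ α - z τ β) ^ 2) τ := by
    refine HasDerivAt.const_mul _ (HasDerivAt.fun_sum fun β _ => ?_)
    by_cases h : α = β
    · subst h
      simpa using hasDerivAt_const τ (0 : ℝ)
    · have := (hasDerivAt_const τ (σ β)).fun_div ((hz α).sub (hz β)) (sub_ne_zero.2 (hinj.ne h))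
      simpa using this
  convert! h1 using 1
  rw [Finset.mul_sum]
  refine Finset.sum_congr rfl fun β _ => ?_
  rw [coulombHess]
  ring

/-- The second order null-vector equation satisfied by Coulomb gas correlations at a unit charge. -/
theorem coulomb_null_vector {κ : ℝ} (hκ : κ ≠ 0) (σ z : ι → ℝ) (hinj : Function.Injective z)
    {j : ι} (hj : σ j = 1) :
    κ / 2 * (-(∑ β, coulombHess κ σ z j β) + coulombForce κ σ z j ^ 2)
      + ∑ α, (2 / (z α - z j) * coulombForce κ σ z α
          - (2 * (σ α * (σ α + 2) / κ - σ α / 2)) / (z α - z j) ^ 2) = 0 := by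
  classical
  have hF : ∀ α, coulombForce κ σ z α = 2 / κ * σ α * ∑ β, σ β / (z α - z β) := fun α => rfl
  -- Separate the interaction with `j`.
  have hsq : coulombForce κ σ z j ^ 2
      = 4 / κ ^ 2 * ∑ α, ∑ β, σ α / (z α - z j) * (σ β / (z β - z j)) := by
    rw [hF, hj, ← Finset.sum_mul_sum, ← sq]
    have : ∑ β, σ β / (z j - z β) = -∑ β, σ β / (z β - z j) := by
      rw [← Finset.sum_neg_distrib]
      exact Finset.sum_congr rfl fun β _ => by rw [← neg_sub (z β), div_neg]
    rw [this]; ring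
  have hlin : ∑ α, 2 / (z α - z j) * coulombForce κ σ z α
      = ∑ α, ∑ β, 4 / κ * (σ α * σ β / ((z α - z j) * (z α - z β))) := by
    refine Finset.sum_congr rfl fun α _ => ?_
    rw [hF, Finset.mul_sum, Finset.mul_sum]
    refine Finset.sum_congr rfl fun β _ => ?_
    rw [div_mul_eq_mul_div, div_mul_eq_mul_div, div_mul_eq_mul_div, mul_comm (z α - z j),
      ← div_div]
    ring
  have hsym : ∑ α, 2 / (z α - z j) * coulombForce κ σ z α
      = ∑ α, ∑ β, 2 / κ * (σ α * σ β / ((z α - z j) * (z α - z β))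
          + σ β * σ α / ((z β - z j) * (z β - z α))) := by
    have h2 : ∑ α, 2 / (z α - z j) * coulombForce κ σ z α
        = 1 / 2 * (∑ α, ∑ β, 4 / κ * (σ α * σ β / ((z α - z j) * (z α - z β)))
          + ∑ α, ∑ β, 4 / κ * (σ β * σ α / ((z β - z j) * (z β - z α)))) := by
      rw [Finset.sum_comm (f := fun α β => 4 / κ * (σ β * σ α / ((z β - z j) * (z β - z α)))),
        ← hlin]
      ring
    rw [h2, ← Finset.sum_add_distrib, Finset.mul_sum]
    refine Finset.sum_congr rfl fun α _ => ?_
    rw [← Finset.sum_add_distrib, Finset.mul_sum]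
    exact Finset.sum_congr rfl fun β _ => by ring
  rw [Finset.sum_sub_distrib, hsym, hsq]
  -- The double sum reduces to its diagonal and to the terms involving `j`.
  have hpair : ∀ α β, 2 / κ * (σ α * σ β / ((z α - z j) * (z α - z β))
          + σ β * σ α / ((z β - z j) * (z β - z α)))
        = -(2 / κ) * (σ α / (z α - z j) * (σ β / (z β - z j)))
          + (if β = α then 2 / κ * (σ α ^ 2 / (z α - z j) ^ 2) else 0)
          + (if β = j then 2 / κ * (σ α / (z α - z j) ^ 2) else 0)
          + (if α = j then 2 / κ * (σ β / (z β - z j) ^ 2) else 0) := by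
    intro α β
    by_cases hab : β = α
    · subst hab
      by_cases hb : β = j
      · subst hb; simp
      · have h3 : z β - z j ≠ 0 := sub_ne_zero.2 (hinj.ne hb)
        simp [hb]
        field_simp
        ring
    · have h1 : z α - z β ≠ 0 := sub_ne_zero.2 (hinj.ne (Ne.symm hab))
      have h1' : z β - z α ≠ 0 := sub_ne_zero.2 (hinj.ne hab)
      by_cases hb : β = j
      · subst hb
        simp [hab, Ne.symm hab, hj]
        left
        ring
      · by_cases ha : α = j
        · subst ha
          simp [hab, hj]
          left
          ring
        · have h2 : z α - z j ≠ 0 := sub_ne_zero.2 (hinj.ne ha)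
          have h3 : z β - z j ≠ 0 := sub_ne_zero.2 (hinj.ne hb)
          rw [if_neg hab, if_neg hb, if_neg ha, ← neg_sub (z α) (z β)]
          field_simp
          ring
  simp only [hpair, Finset.sum_add_distrib, Finset.sum_ite_eq', Finset.mem_univ, if_true]
  have hdiag : ∑ α, ∑ β, (if α = j then 2 / κ * (σ β / (z β - z j) ^ 2) else 0)
      = ∑ β, 2 / κ * (σ β / (z β - z j) ^ 2) := by
    rw [Finset.sum_comm]; simp
  have hH : ∑ β, coulombHess κ σ z j β = ∑ β, 2 / κ * (σ β / (z β - z j) ^ 2) := by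
    refine Finset.sum_congr rfl fun β _ => ?_
    rw [coulombHess, hj, ← neg_sub (z β), neg_sq]; ring
  rw [hdiag, hH]
  have hh : ∑ α, (2 * (σ α * (σ α + 2) / κ - σ α / 2)) / (z α - z j) ^ 2
      = ∑ α, 2 / κ * (σ α ^ 2 / (z α - z j) ^ 2) + 2 * ∑ α, 2 / κ * (σ α / (z α - z j) ^ 2)
        - κ / 2 * ∑ α, 2 / κ * (σ α / (z α - z j) ^ 2) := by
    rw [Finset.mul_sum, Finset.mul_sum, ← Finset.sum_add_distrib, ← Finset.sum_sub_distrib]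
    refine Finset.sum_congr rfl fun α _ => ?_
    field_simp
  rw [hh]
  simp only [← Finset.mul_sum, ← Finset.sum_mul]
  generalize ∑ α, σ α / (z α - z j) ^ 2 = D
  generalize ∑ α, σ α ^ 2 / (z α - z j) ^ 2 = D'
  generalize ∑ α, σ α / (z α - z j) = A
  field_simp
  ring

end Coulomb

section Configuration

variable {N : ℕ}

/-- The length of the `r`-th integration interval. -/
def cgGap (x : Fin (2 * N) → ℝ) (r : Fin N) : ℝ := x (idxB N r) - x (idxA N r)

/-- The position of the `r`-th screening charge, parametrized by the unit cube. -/
def cgScreen (x : Fin (2 * N) → ℝ) (t : Fin N → ℝ) (r : Fin N) : ℝ :=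
  x (idxA N r) + cgGap x r * t r

/-- The positions of all charges. -/
def cgPos (x : Fin (2 * N) → ℝ) (t : Fin N → ℝ) : Fin (2 * N) ⊕ Fin N → ℝ :=
  Sum.elim x (cgScreen x t)

/-- The charges: `1` at the marked points, `-2` at the screening positions. -/
def cgCharge (N : ℕ) : Fin (2 * N) ⊕ Fin N → ℝ :=
  Sum.elim (fun _ => 1) fun _ => -2

/-- The difference `u_r - x_i`, with the factors vanishing on the boundary of the unit cube
removed when `x_i` is an endpoint of the `r`-th interval. -/
def cgDiff (x : Fin (2 * N) → ℝ) (t : Fin N → ℝ) (r : Fin N) (i : Fin (2 * N)) : ℝ :=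
  if i = idxA N r ∨ i = idxB N r then cgGap x r else cgScreen x t r - x i

/-- The logarithm of the regular part of the integrand on the unit cube. -/
def cgLog (κ : ℝ) (q : (Fin (2 * N) → ℝ) × (Fin N → ℝ)) : ℝ :=
  1 / κ * ∑ i, ∑ k, Real.log (q.1 i - q.1 k)
    + 4 / κ * ∑ r, ∑ s, Real.log (cgScreen q.1 q.2 r - cgScreen q.1 q.2 s)
    - 4 / κ * ∑ r, ∑ i, Real.log (cgDiff q.1 q.2 r i) + ∑ r, Real.log (cgGap q.1 r)

/-- The regular part of the integrand on the unit cube. -/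
def cgReg (κ : ℝ) (q : (Fin (2 * N) → ℝ) × (Fin N → ℝ)) : ℝ :=
  cgConst κ ^ N * Real.exp (cgLog κ q)

theorem idxA_ne_idxB (r s : Fin N) : idxA N r ≠ idxB N s := by
  intro h
  simp only [idxA, idxB, Fin.mk.injEq] at h
  omega

theorem idxA_injective : Function.Injective (idxA N) := by
  intro r s h
  simp only [idxA, Fin.mk.injEq] at h
  exact Fin.ext (by omega)

theorem idxB_injective : Function.Injective (idxB N) := by
  intro r s h
  simp only [idxB, Fin.mk.injEq] at h
  exact Fin.ext (by omega)

theorem exists_eq_idx (j : Fin (2 * N)) : ∃ r, j = idxA N r ∨ j = idxB N r := by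
  refine ⟨⟨j / 2, by have := j.isLt; omega⟩, ?_⟩
  simp only [idxA, idxB, Fin.ext_iff]
  omega

theorem isOpen_chamber (n : ℕ) : IsOpen (chamber n) := by
  have : chamber n = ⋂ i : Fin n, ⋂ k : Fin n, {x | i < k → x i < x k} := by
    ext x; simp [chamber, StrictMono]
  rw [this]
  refine isOpen_iInter_of_finite fun i => isOpen_iInter_of_finite fun k => ?_
  by_cases h : i < k
  · simpa [h] using isOpen_lt (continuous_apply i) (continuous_apply k)
  · simp [h]

variable {x : Fin (2 * N) → ℝ} {t : Fin N → ℝ}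

theorem cgGap_pos (hx : x ∈ chamber (2 * N)) (r : Fin N) : 0 < cgGap x r :=
  sub_pos.2 (hx (by simp [idxA, idxB, Fin.lt_def]))

theorem idxA_le_cgScreen (hx : x ∈ chamber (2 * N)) (ht : t ∈ unitCube N) (r : Fin N) :
    x (idxA N r) ≤ cgScreen x t r :=
  le_add_of_nonneg_right (mul_nonneg (cgGap_pos hx r).le (ht r trivial).1)

theorem cgScreen_le_idxB (hx : x ∈ chamber (2 * N)) (ht : t ∈ unitCube N) (r : Fin N) :
    cgScreen x t r ≤ x (idxB N r) := by
  have h1 := (ht r trivial).2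
  have h2 := cgGap_pos hx r
  have h3 : x (idxB N r) = x (idxA N r) + cgGap x r := by rw [cgGap]; ring
  rw [h3, cgScreen]
  nlinarith

theorem cgScreen_strictMono (hx : x ∈ chamber (2 * N)) (ht : t ∈ unitCube N) :
    StrictMono (cgScreen x t) := by
  intro r s hrs
  have h : x (idxB N r) < x (idxA N s) := hx (by
    simp only [idxA, idxB, Fin.lt_def] at hrs ⊢; omega)
  exact (cgScreen_le_idxB hx ht r).trans_lt (h.trans_le (idxA_le_cgScreen hx ht s))

theorem cgScreen_ne (hx : x ∈ chamber (2 * N)) (ht : t ∈ unitCube N) {r : Fin N}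
    {i : Fin (2 * N)} (hA : i ≠ idxA N r) (hB : i ≠ idxB N r) : cgScreen x t r ≠ x i := by
  rcases lt_or_gt_of_ne hA with h | h
  · exact ((hx h).trans_le (idxA_le_cgScreen hx ht r)).ne'
  · have h' : idxB N r < i := by
      refine lt_of_le_of_ne ?_ (Ne.symm hB)
      simp only [idxA, idxB, Fin.lt_def, Fin.le_def] at h ⊢
      omega
    exact ((cgScreen_le_idxB hx ht r).trans_lt (hx h')).ne

theorem cgScreen_mem_Ioo (hx : x ∈ chamber (2 * N)) (ht : t ∈ openCube N) (r : Fin N) :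
    cgScreen x t r ∈ Set.Ioo (x (idxA N r)) (x (idxB N r)) := by
  have h1 := (ht r trivial).1
  have h2 := (ht r trivial).2
  have h3 := cgGap_pos hx r
  have h4 : x (idxB N r) = x (idxA N r) + cgGap x r := by rw [cgGap]; ring
  rw [Set.mem_Ioo, h4, cgScreen]
  constructor <;> nlinarith

theorem cgScreen_ne_of_mem_openCube (hx : x ∈ chamber (2 * N)) (ht : t ∈ openCube N) (r : Fin N)
    (i : Fin (2 * N)) : cgScreen x t r ≠ x i := by
  by_cases hA : i = idxA N r
  · exact hA ▸ (cgScreen_mem_Ioo hx ht r).1.ne'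
  by_cases hB : i = idxB N r
  · exact hB ▸ (cgScreen_mem_Ioo hx ht r).2.ne
  exact cgScreen_ne hx (openCube_subset_unitCube ht) hA hB

theorem cgPos_injective (hx : x ∈ chamber (2 * N)) (ht : t ∈ openCube N) :
    Function.Injective (cgPos x t) :=
  Function.Injective.sumElim hx.injective
    (cgScreen_strictMono hx (openCube_subset_unitCube ht)).injective
    fun i r => (cgScreen_ne_of_mem_openCube hx ht r i).symm

theorem cgDiff_ne_zero (hx : x ∈ chamber (2 * N)) (ht : t ∈ unitCube N) (r : Fin N)
    (i : Fin (2 * N)) : cgDiff x t r i ≠ 0 := by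
  unfold cgDiff
  split_ifs with h
  · exact (cgGap_pos hx r).ne'
  · rw [not_or] at h
    exact sub_ne_zero.2 (cgScreen_ne hx ht h.1 h.2)

theorem contDiff_cgGap (r : Fin N) :
    ContDiff ℝ (⊤ : ℕ∞) fun q : (Fin (2 * N) → ℝ) × (Fin N → ℝ) => cgGap q.1 r := by
  unfold cgGap
  fun_prop

theorem contDiff_cgScreen (r : Fin N) :
    ContDiff ℝ (⊤ : ℕ∞) fun q : (Fin (2 * N) → ℝ) × (Fin N → ℝ) => cgScreen q.1 q.2 r := by
  unfold cgScreen cgGap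
  fun_prop

theorem contDiff_cgDiff (r : Fin N) (i : Fin (2 * N)) :
    ContDiff ℝ (⊤ : ℕ∞) fun q : (Fin (2 * N) → ℝ) × (Fin N → ℝ) => cgDiff q.1 q.2 r i := by
  unfold cgDiff
  split_ifs
  · exact contDiff_cgGap r
  · exact (contDiff_cgScreen r).sub (by fun_prop)

theorem contDiffAt_cgReg (κ : ℝ) (hx : x ∈ chamber (2 * N)) (ht : t ∈ unitCube N) :
    ContDiffAt ℝ (⊤ : ℕ∞) (cgReg κ) (x, t) := by
  refine contDiffAt_const.mul (ContDiffAt.exp ?_)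
  refine (((contDiffAt_const.mul ?_).add (contDiffAt_const.mul ?_)).sub
    (contDiffAt_const.mul ?_)).add ?_
  · refine ContDiffAt.sum fun i _ => ContDiffAt.sum fun k _ => ?_
    by_cases h : i = k
    · subst h; simpa using contDiffAt_const
    · exact ContDiffAt.log (by fun_prop) (sub_ne_zero.2 (hx.injective.ne h))
  · refine ContDiffAt.sum fun r _ => ContDiffAt.sum fun s _ => ?_
    by_cases h : r = s
    · subst h; simpa using contDiffAt_const
    · exact ContDiffAt.log ((contDiff_cgScreen r).sub (contDiff_cgScreen s)).contDiffAt
        (sub_ne_zero.2 ((cgScreen_strictMono hx ht).injective.ne h))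
  · exact ContDiffAt.sum fun r _ => ContDiffAt.sum fun i _ =>
      (contDiff_cgDiff r i).contDiffAt.log (cgDiff_ne_zero hx ht r i)
  · exact ContDiffAt.sum fun r _ => (contDiff_cgGap r).contDiffAt.log (cgGap_pos hx r).ne'

theorem sum_log_cgDiff (hx : x ∈ chamber (2 * N)) (ht : t ∈ openCube N) (r : Fin N) :
    ∑ i, Real.log (cgDiff x t r i)
      = ∑ i, Real.log (cgScreen x t r - x i) - Real.log (t r) - Real.log (1 - t r) := by
  have h : ∀ i, Real.log (cgDiff x t r i) = Real.log (cgScreen x t r - x i)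
      - (if i = idxA N r then Real.log (t r) else 0)
      - (if i = idxB N r then Real.log (1 - t r) else 0) := by
    intro i
    have hg := (cgGap_pos hx r).ne'
    unfold cgDiff
    by_cases hA : i = idxA N r
    · have hB : i ≠ idxB N r := hA ▸ idxA_ne_idxB r r
      rw [if_pos (Or.inl hA), if_pos hA, if_neg hB, hA, cgScreen, add_sub_cancel_left,
        Real.log_mul hg (ht r trivial).1.ne']
      ring
    by_cases hB : i = idxB N r
    · have h1 : cgScreen x t r - x i = -(cgGap x r * (1 - t r)) := by
        rw [hB, cgScreen, cgGap]; ring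
      rw [if_pos (Or.inr hB), if_neg hA, if_pos hB, h1, Real.log_neg_eq_log,
        Real.log_mul hg (sub_pos.2 (ht r trivial).2).ne']
      ring
    · rw [if_neg (not_or.2 ⟨hA, hB⟩), if_neg hA, if_neg hB]; ring
  simp only [h, Finset.sum_sub_distrib, Finset.sum_ite_eq', Finset.mem_univ, if_true]

theorem coulombLog_cgPos (κ : ℝ) (x : Fin (2 * N) → ℝ) (t : Fin N → ℝ) :
    coulombLog κ (cgCharge N) (cgPos x t)
      = 1 / κ * ∑ i, ∑ k, Real.log (x i - x k)
        + 4 / κ * ∑ r, ∑ s, Real.log (cgScreen x t r - cgScreen x t s)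
        - 4 / κ * ∑ r, ∑ i, Real.log (cgScreen x t r - x i) := by
  have h : ∑ i, ∑ r, Real.log (x i - cgScreen x t r)
      = ∑ r, ∑ i, Real.log (cgScreen x t r - x i) := by
    rw [Finset.sum_comm]
    exact Finset.sum_congr rfl fun r _ => Finset.sum_congr rfl fun i _ => by
      rw [← neg_sub, Real.log_neg_eq_log]
  simp only [coulombLog, Fintype.sum_sum_type, cgCharge, cgPos, Sum.elim_inl, Sum.elim_inr,
    Finset.sum_add_distrib, ← Finset.mul_sum, h]
  ring

theorem cgLog_eq (κ : ℝ) (hx : x ∈ chamber (2 * N)) (ht : t ∈ openCube N) :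
    cgLog κ (x, t) = coulombLog κ (cgCharge N) (cgPos x t) + ∑ r, Real.log (cgGap x r)
      + 4 / κ * ∑ r, (Real.log (t r) + Real.log (1 - t r)) := by
  rw [coulombLog_cgPos, cgLog]
  simp only [sum_log_cgDiff hx ht, Finset.sum_sub_distrib, Finset.sum_add_distrib]
  ring

end Configuration

section ChangeOfVariables

theorem prod_rpow_sub_eq_exp {n : ℕ} (c : ℝ) {z : Fin n → ℝ} (hz : StrictMono z) :
    (∏ i, ∏ k, if i < k then (z k - z i) ^ c else 1)
      = Real.exp (c / 2 * ∑ i, ∑ k, Real.log (z i - z k)) := by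
  have h1 : ∀ i k, (if i < k then (z k - z i) ^ c else 1)
      = Real.exp (if i < k then c * Real.log (z i - z k) else 0) := by
    intro i k
    split_ifs with h
    · rw [Real.rpow_def_of_pos (sub_pos.2 (hz h)), ← neg_sub (z i), Real.log_neg_eq_log, mul_comm]
    · rw [Real.exp_zero]
  simp only [h1, ← Real.exp_sum]
  congr 1
  have h2 : ∑ i, ∑ k, Real.log (z i - z k)
      = ∑ i, ∑ k, (if i < k then Real.log (z i - z k) else 0)
        + ∑ i, ∑ k, (if i < k then Real.log (z i - z k) else 0) := by
    conv_rhs => rw [add_comm]; enter [1]; rw [Finset.sum_comm]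
    rw [← Finset.sum_add_distrib]
    refine Finset.sum_congr rfl fun i _ => ?_
    rw [← Finset.sum_add_distrib]
    refine Finset.sum_congr rfl fun k _ => ?_
    rcases lt_trichotomy i k with h | h | h
    · simp [h, h.not_gt]
    · simp [h]
    · rw [if_pos h, if_neg h.not_gt, add_zero, ← neg_sub, Real.log_neg_eq_log]
  rw [h2, ← two_mul, ← mul_assoc, div_mul_cancel₀ c two_ne_zero, Finset.mul_sum]
  refine Finset.sum_congr rfl fun i _ => ?_
  rw [Finset.mul_sum]
  refine Finset.sum_congr rfl fun k _ => ?_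
  rw [mul_ite, mul_zero]

variable {N : ℕ} {x : Fin (2 * N) → ℝ} {t : Fin N → ℝ}

theorem integrand_cgScreen_eq (κ : ℝ) (hx : x ∈ chamber (2 * N)) (ht : t ∈ openCube N) :
    (∏ i, ∏ k, if i < k then (x k - x i) ^ (2 / κ) else 1)
        * ((∏ r, cgGap x r) * cgIntegrand κ N x (cgScreen x t))
      = betaWeight (-(4 / κ)) t * Real.exp (cgLog κ (x, t)) := by
  have hu := cgScreen_strictMono hx (openCube_subset_unitCube ht)
  have h1 : ∏ r, ∏ i, |cgScreen x t r - x i| ^ (-(4 / κ))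
      = Real.exp (-(4 / κ) * ∑ r, ∑ i, Real.log (cgScreen x t r - x i)) := by
    simp only [Finset.mul_sum, Real.exp_sum]
    refine Finset.prod_congr rfl fun r _ => Finset.prod_congr rfl fun i _ => ?_
    rw [Real.rpow_def_of_pos (abs_pos.2 (sub_ne_zero.2 (cgScreen_ne_of_mem_openCube hx ht r i))),
      Real.log_abs, mul_comm]
  have h2 : ∏ r, cgGap x r = Real.exp (∑ r, Real.log (cgGap x r)) := by
    rw [Real.exp_sum]
    exact Finset.prod_congr rfl fun r _ => (Real.exp_log (cgGap_pos hx r)).symm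
  have h3 : betaWeight (-(4 / κ)) t
      = Real.exp (-(4 / κ) * ∑ r, (Real.log (t r) + Real.log (1 - t r))) := by
    rw [betaWeight, Finset.mul_sum, Real.exp_sum]
    refine Finset.prod_congr rfl fun r _ => ?_
    have h0 := (ht r trivial).1
    have h0' : 0 < 1 - t r := sub_pos.2 (ht r trivial).2
    rw [Real.rpow_def_of_pos (mul_pos h0 h0'), Real.log_mul h0.ne' h0'.ne', mul_comm]
  rw [cgIntegrand, prod_rpow_sub_eq_exp _ hx, prod_rpow_sub_eq_exp _ hu, h1, h2, h3,
    cgLog_eq κ hx ht, coulombLog_cgPos, ← Real.exp_add, ← Real.exp_add, ← Real.exp_add,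
    ← Real.exp_add]
  congr 1
  ring

theorem image_cgScreen_openCube (hx : x ∈ chamber (2 * N)) :
    cgScreen x '' openCube N = cgBox N x := by
  ext u
  constructor
  · rintro ⟨t, ht, rfl⟩ r -
    exact cgScreen_mem_Ioo hx ht r
  · intro hu
    refine ⟨fun r => (u r - x (idxA N r)) / cgGap x r, fun r _ => ?_, ?_⟩
    · have h := hu r trivial
      have hg := cgGap_pos hx r
      exact ⟨div_pos (sub_pos.2 h.1) hg, (div_lt_one hg).2 (sub_lt_sub_right h.2 _)⟩
    · funext r
      rw [cgScreen, mul_div_cancel₀ _ (cgGap_pos hx r).ne']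
      ring

theorem setIntegral_cgBox (hx : x ∈ chamber (2 * N)) (g : (Fin N → ℝ) → ℝ) :
    ∫ u in cgBox N x, g u = ∫ t in openCube N, (∏ r, cgGap x r) * g (cgScreen x t) := by
  have hinj : Set.InjOn (cgScreen x) (openCube N) := by
    intro t _ t' _ h
    funext r
    have := congrFun h r
    rw [cgScreen, cgScreen, add_right_inj] at this
    exact mul_left_cancel₀ (cgGap_pos hx r).ne' this
  let D : (Fin N → ℝ) →L[ℝ] (Fin N → ℝ) := ContinuousLinearMap.pi fun r =>
    (cgGap x r • ContinuousLinearMap.id ℝ ℝ).comp (ContinuousLinearMap.proj r)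
  have hD : ∀ t ∈ openCube N, HasFDerivWithinAt (cgScreen x) D (openCube N) t := by
    intro t _
    rw [hasFDerivWithinAt_pi']
    intro r
    have : HasFDerivAt (fun t : Fin N → ℝ => cgScreen x t r)
        (cgGap x r • (ContinuousLinearMap.proj r : (Fin N → ℝ) →L[ℝ] ℝ)) t :=
      ((hasFDerivAt_apply r t).const_mul (cgGap x r)).const_add (x (idxA N r))
    convert! this.hasFDerivWithinAt using 1
  have hdet : D.det = ∏ r, cgGap x r := by
    refine (ContinuousLinearMap.det_pi fun r => cgGap x r • ContinuousLinearMap.id ℝ ℝ).trans ?_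
    refine Finset.prod_congr rfl fun r _ => ?_
    change LinearMap.det (cgGap x r • LinearMap.id) = cgGap x r
    rw [LinearMap.det_smul, LinearMap.det_id, Module.finrank_self, pow_one, mul_one]
  rw [← image_cgScreen_openCube hx,
    integral_image_eq_integral_abs_det_fderiv_smul volume measurableSet_openCube hD hinj, hdet,
    abs_of_pos (Finset.prod_pos fun r _ => cgGap_pos hx r)]
  rfl

theorem cgG_eq_integral (κ : ℝ) (hx : x ∈ chamber (2 * N)) :
    cgG κ N x = ∫ t, cgReg κ (x, t) ∂betaMeasure N (-(4 / κ)) := by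
  rw [integral_betaMeasure, cgG, setIntegral_cgBox hx, ← integral_const_mul]
  refine setIntegral_congr_fun measurableSet_openCube fun t ht => ?_
  rw [mul_assoc, integrand_cgScreen_eq κ hx ht, cgReg]
  ring

end ChangeOfVariables

section Derivatives

variable {N : ℕ}

/-- The derivative of the length of the `r`-th interval with respect to `x_i`. -/
def cgEps (r : Fin N) (i : Fin (2 * N)) : ℝ :=
  (if idxB N r = i then 1 else 0) - (if idxA N r = i then 1 else 0)

/-- The derivative of the `r`-th screening position with respect to `x_i`. -/
def cgLam (t : Fin N → ℝ) (r : Fin N) (i : Fin (2 * N)) : ℝ :=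
  (if idxA N r = i then 1 else 0) * (1 - t r) + (if idxB N r = i then 1 else 0) * t r

/-- The velocity of the configuration of charges when `x_i` moves with unit speed. -/
def cgVel (t : Fin N → ℝ) (i : Fin (2 * N)) : Fin (2 * N) ⊕ Fin N → ℝ :=
  Sum.elim (Pi.single i 1) fun r => cgLam t r i

/-- The force acting on a charge of the configuration. -/
def cgForce (κ : ℝ) (x : Fin (2 * N) → ℝ) (t : Fin N → ℝ) : Fin (2 * N) ⊕ Fin N → ℝ :=
  coulombForce κ (cgCharge N) (cgPos x t)

/-- The interaction coefficients of the configuration. -/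
def cgHess (κ : ℝ) (x : Fin (2 * N) → ℝ) (t : Fin N → ℝ) :
    Fin (2 * N) ⊕ Fin N → Fin (2 * N) ⊕ Fin N → ℝ :=
  coulombHess κ (cgCharge N) (cgPos x t)

/-- The logarithmic derivative of the integrand with respect to `x_i`. -/
def cgEll (κ : ℝ) (x : Fin (2 * N) → ℝ) (t : Fin N → ℝ) (i : Fin (2 * N)) : ℝ :=
  ∑ α, cgVel t i α * cgForce κ x t α + ∑ r, cgEps r i / cgGap x r

/-- The derivative of `cgEll` at `i` with respect to `x_i`. -/
def cgEllDeriv (κ : ℝ) (x : Fin (2 * N) → ℝ) (t : Fin N → ℝ) (i : Fin (2 * N)) : ℝ :=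
  ∑ α, cgVel t i α * ∑ β, cgHess κ x t α β * (cgVel t i β - cgVel t i α)
    - ∑ r, cgEps r i ^ 2 / cgGap x r ^ 2

theorem hasDerivAt_update_apply {ι : Type*} [Fintype ι] [DecidableEq ι] (x : ι → ℝ) (i k : ι)
    (τ : ℝ) : HasDerivAt (fun τ => Function.update x i τ k) (if k = i then 1 else 0) τ := by
  have := hasDerivAt_pi.1 (hasDerivAt_update x i τ) k
  rwa [Pi.single_apply] at this

theorem hasDerivAt_cgGap (x : Fin (2 * N) → ℝ) (i : Fin (2 * N)) (r : Fin N) (τ : ℝ) :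
    HasDerivAt (fun τ => cgGap (Function.update x i τ) r) (cgEps r i) τ :=
  (hasDerivAt_update_apply x i _ τ).sub (hasDerivAt_update_apply x i _ τ)

theorem hasDerivAt_cgPos (x : Fin (2 * N) → ℝ) (t : Fin N → ℝ) (i : Fin (2 * N))
    (α : Fin (2 * N) ⊕ Fin N) (τ : ℝ) :
    HasDerivAt (fun τ => cgPos (Function.update x i τ) t α) (cgVel t i α) τ := by
  rcases α with k | r
  · simp only [cgPos, cgVel, Sum.elim_inl, Pi.single_apply]
    exact hasDerivAt_update_apply x i k τ
  · simp only [cgPos, cgVel, Sum.elim_inr, cgScreen]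
    convert! (hasDerivAt_update_apply x i (idxA N r) τ).add
      ((hasDerivAt_cgGap x i r τ).mul_const (t r)) using 1
    rw [cgLam, cgEps]
    ring

theorem hasDerivAt_cgPos_snd (x : Fin (2 * N) → ℝ) (t : Fin N → ℝ) (s : Fin N)
    (α : Fin (2 * N) ⊕ Fin N) (τ : ℝ) :
    HasDerivAt (fun τ => cgPos x (Function.update t s τ) α)
      ((Pi.single (Sum.inr s) (cgGap x s) : Fin (2 * N) ⊕ Fin N → ℝ) α) τ := by
  rcases α with k | r
  · simpa [cgPos] using hasDerivAt_const τ (x k)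
  · simp only [cgPos, Sum.elim_inr, cgScreen]
    convert! ((hasDerivAt_update_apply t s r τ).const_mul (cgGap x r)).const_add
      (x (idxA N r)) using 1
    by_cases h : r = s
    · subst h; simp
    · simp [h]

variable {x : Fin (2 * N) → ℝ} {t : Fin N → ℝ}

theorem eventually_update_mem_chamber (hx : x ∈ chamber (2 * N)) (i : Fin (2 * N)) :
    ∀ᶠ τ in 𝓝 (x i), Function.update x i τ ∈ chamber (2 * N) := by
  have hc : ContinuousAt (fun τ => Function.update x i τ) (x i) :=
    (hasDerivAt_update x i (x i)).continuousAt
  refine hc.eventually_mem ((isOpen_chamber _).mem_nhds ?_)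
  rwa [Function.update_eq_self]

theorem eventually_update_mem_openCube (ht : t ∈ openCube N) (s : Fin N) :
    ∀ᶠ τ in 𝓝 (t s), Function.update t s τ ∈ openCube N := by
  have hc : ContinuousAt (fun τ => Function.update t s τ) (t s) :=
    (hasDerivAt_update t s (t s)).continuousAt
  refine hc.eventually_mem (IsOpen.mem_nhds ?_ ?_)
  · exact isOpen_set_pi Set.finite_univ fun _ _ => isOpen_Ioo
  · rwa [Function.update_eq_self]

theorem hasDerivAt_cgReg_fst (κ : ℝ) (hx : x ∈ chamber (2 * N)) (ht : t ∈ openCube N)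
    (i : Fin (2 * N)) :
    HasDerivAt (fun τ => cgReg κ (Function.update x i τ, t))
      (cgReg κ (x, t) * cgEll κ x t i) (x i) := by
  have hlog : HasDerivAt (fun τ => cgLog κ (Function.update x i τ, t)) (cgEll κ x t i) (x i) := by
    have h1 := hasDerivAt_coulombLog κ (cgCharge N)
      (fun α => hasDerivAt_cgPos x t i α (x i))
      (by rw [Function.update_eq_self]; exact cgPos_injective hx ht)
    have h2 : HasDerivAt (fun τ => ∑ r, Real.log (cgGap (Function.update x i τ) r))
        (∑ r, cgEps r i / cgGap (Function.update x i (x i)) r) (x i) :=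
      HasDerivAt.fun_sum fun r _ => (hasDerivAt_cgGap x i r (x i)).log (by
        rw [Function.update_eq_self]; exact (cgGap_pos hx r).ne')
    have h3 := (h1.add h2).add_const (4 / κ * ∑ r, (Real.log (t r) + Real.log (1 - t r)))
    simp only [Function.update_eq_self] at h3
    refine h3.congr_of_eventuallyEq ?_
    filter_upwards [eventually_update_mem_chamber hx i] with τ hτ
    exact cgLog_eq κ hτ ht
  have := (hlog.exp).const_mul (cgConst κ ^ N)
  simp only [Function.update_eq_self] at this
  rwa [← mul_assoc] at this

theorem hasDerivAt_cgEll (κ : ℝ) (hx : x ∈ chamber (2 * N)) (ht : t ∈ openCube N)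
    (i : Fin (2 * N)) :
    HasDerivAt (fun τ => cgEll κ (Function.update x i τ) t i) (cgEllDeriv κ x t i) (x i) := by
  have h1 : HasDerivAt (fun τ => ∑ α, cgVel t i α * cgForce κ (Function.update x i τ) t α)
      _ (x i) :=
    HasDerivAt.fun_sum fun α _ => (hasDerivAt_coulombForce κ (cgCharge N)
      (fun α => hasDerivAt_cgPos x t i α (x i))
      (by rw [Function.update_eq_self]; exact cgPos_injective hx ht) α).const_mul (cgVel t i α)
  have h2 : HasDerivAt (fun τ => ∑ r, cgEps r i / cgGap (Function.update x i τ) r)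
      (∑ r, -(cgEps r i ^ 2 / cgGap x r ^ 2)) (x i) := by
    refine HasDerivAt.fun_sum fun r _ => ?_
    have := (hasDerivAt_const (x i) (cgEps r i)).fun_div (hasDerivAt_cgGap x i r (x i)) (by
      rw [Function.update_eq_self]; exact (cgGap_pos hx r).ne')
    simp only [Function.update_eq_self] at this
    convert! this using 1
    ring
  have h3 := h1.add h2
  simp only [Function.update_eq_self, Finset.sum_neg_distrib, ← sub_eq_add_neg] at h3
  exact h3

theorem hasDerivAt_cgReg_snd (κ : ℝ) (hx : x ∈ chamber (2 * N)) (ht : t ∈ openCube N)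
    (s : Fin N) :
    HasDerivAt (fun τ => cgReg κ (x, Function.update t s τ))
      (cgReg κ (x, t) * (cgGap x s * cgForce κ x t (Sum.inr s)
        + 4 / κ * (1 / t s - 1 / (1 - t s)))) (t s) := by
  have hlog : HasDerivAt (fun τ => cgLog κ (x, Function.update t s τ))
      (cgGap x s * cgForce κ x t (Sum.inr s) + 4 / κ * (1 / t s - 1 / (1 - t s))) (t s) := by
    have h1 := hasDerivAt_coulombLog κ (cgCharge N)
      (fun α => hasDerivAt_cgPos_snd x t s α (t s))
      (by rw [Function.update_eq_self]; exact cgPos_injective hx ht)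
    have h2 : HasDerivAt (fun τ => ∑ r, (Real.log (Function.update t s τ r)
        + Real.log (1 - Function.update t s τ r)))
        (∑ r, ((if r = s then 1 else 0) / t r + -(if r = s then 1 else 0) / (1 - t r))) (t s) := by
      refine HasDerivAt.fun_sum fun r _ => ?_
      have hu := hasDerivAt_update_apply t s r (t s)
      have h := (hu.log (by rw [Function.update_eq_self]; exact (ht r trivial).1.ne')).add
        ((hu.const_sub 1).log (by
          rw [Function.update_eq_self]; exact (sub_pos.2 (ht r trivial).2).ne'))
      simp only [Function.update_eq_self] at h
      exact h
    have h3 := (h1.add_const (∑ r, Real.log (cgGap x r))).add (h2.const_mul (4 / κ))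
    simp only [Function.update_eq_self] at h3
    have e1 : ∑ α, (Pi.single (Sum.inr s) (cgGap x s) : Fin (2 * N) ⊕ Fin N → ℝ) α
        * coulombForce κ (cgCharge N) (cgPos x t) α = cgGap x s * cgForce κ x t (Sum.inr s) := by
      simp [Pi.single_apply, cgForce]
    have e2 : ∑ r, ((if r = s then (1 : ℝ) else 0) / t r + -(if r = s then 1 else 0) / (1 - t r))
        = 1 / t s - 1 / (1 - t s) := by
      rw [Finset.sum_eq_single s (fun r _ h => by simp [h]) (by simp)]
      simp only [if_true]
      ring
    rw [e1, e2] at h3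
    refine h3.congr_of_eventuallyEq ?_
    filter_upwards [eventually_update_mem_openCube ht s] with τ hτ
    exact cgLog_eq κ hx hτ
  have := (hlog.exp).const_mul (cgConst κ ^ N)
  simp only [Function.update_eq_self] at this
  rwa [← mul_assoc] at this

end Derivatives

section VectorField

variable {N : ℕ}

/-- The `u_s`-component of the vector field whose divergence against the integrand is the
BPZ operator applied to the integrand. -/
def cgField (κ : ℝ) (j : Fin (2 * N)) (x : Fin (2 * N) → ℝ) (t : Fin N → ℝ) (s : Fin N) : ℝ :=
  κ / 2 * (2 * cgLam t s j * cgForce κ x t (Sum.inl j)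
      + cgLam t s j ^ 2 * cgForce κ x t (Sum.inr s))
    + 2 * ((1 - t s) / (x (idxA N s) - x j) + t s / (x (idxB N s) - x j))
    - 2 / (cgScreen x t s - x j)

/-- The derivative of `cgField` at `s` with respect to `u_s`. -/
def cgFieldDeriv (κ : ℝ) (j : Fin (2 * N)) (x : Fin (2 * N) → ℝ) (t : Fin N → ℝ) (s : Fin N) : ℝ :=
  κ / 2 * (2 * (cgEps s j / cgGap x s * cgForce κ x t (Sum.inl j)
        + cgLam t s j * cgHess κ x t (Sum.inl j) (Sum.inr s))
      + 2 * cgLam t s j * (cgEps s j / cgGap x s) * cgForce κ x t (Sum.inr s)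
      - cgLam t s j ^ 2 * ∑ β, cgHess κ x t (Sum.inr s) β)
    + 2 * (1 / (x (idxB N s) - x j) - 1 / (x (idxA N s) - x j)) / cgGap x s
    + 2 / (cgScreen x t s - x j) ^ 2

/-- The regular factor of `cgField`, for `x_o` the partner of `x_j` in its pair. -/
def cgFactor (j o : Fin (2 * N)) (x : Fin (2 * N) → ℝ) (s : Fin N) (t : Fin N → ℝ) : ℝ :=
  if j = idxA N s ∨ j = idxB N s then
    2 / cgGap x s *
      (∑ i ∈ Finset.univ \ {j, o}, (x o - x i) / ((x j - x i) * (cgScreen x t s - x i))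
        - 2 * ∑ r ∈ Finset.univ \ {s}, (x o - cgScreen x t r)
            / ((x j - cgScreen x t r) * (cgScreen x t s - cgScreen x t r)))
  else 2 * cgGap x s
    / ((x (idxA N s) - x j) * (x (idxB N s) - x j) * (cgScreen x t s - x j))

variable {x : Fin (2 * N) → ℝ} {t : Fin N → ℝ}

theorem hasDerivAt_cgField (κ : ℝ) (j : Fin (2 * N)) (hx : x ∈ chamber (2 * N))
    (ht : t ∈ openCube N) (s : Fin N) :
    HasDerivAt (fun τ => cgField κ j x (Function.update t s τ) s)
      (cgGap x s * cgFieldDeriv κ j x t s) (t s) := by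
  have hg := (cgGap_pos hx s).ne'
  obtain ⟨v, hv⟩ : ∃ v, v = (Pi.single (Sum.inr s) (cgGap x s) : Fin (2 * N) ⊕ Fin N → ℝ) := ⟨_, rfl⟩
  have hF : ∀ α, HasDerivAt (fun τ => cgForce κ x (Function.update t s τ) α)
      (∑ β, cgHess κ x t α β * (v β
        - v α)) (t s) := by
    intro α
    have := hasDerivAt_coulombForce κ (cgCharge N)
      (fun α => hasDerivAt_cgPos_snd x t s α (t s))
      (by rw [Function.update_eq_self]; exact cgPos_injective hx ht) α
    simp only [Function.update_eq_self, ← hv] at this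
    exact this
  have hFj := hF (Sum.inl j)
  have hFs := hF (Sum.inr s)
  have ej : ∑ β, cgHess κ x t (Sum.inl j) β * (v β
      - v (Sum.inl j))
      = cgGap x s * cgHess κ x t (Sum.inl j) (Sum.inr s) := by
    simp [hv, Pi.single_apply, mul_comm]
  have es : ∑ β, cgHess κ x t (Sum.inr s) β * (v β
      - v (Sum.inr s))
      = -(cgGap x s * ∑ β, cgHess κ x t (Sum.inr s) β) := by
    have h0 : cgHess κ x t (Sum.inr s) (Sum.inr s) = 0 := coulombHess_self _ _ _ _
    simp only [hv, mul_sub, Finset.sum_sub_distrib, Pi.single_eq_same, ← Finset.sum_mul]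
    simp [Pi.single_apply, h0, mul_comm]
  rw [ej] at hFj
  rw [es] at hFs
  have hts : HasDerivAt (fun τ => Function.update t s τ s) 1 (t s) := by
    simpa using hasDerivAt_update_apply t s s (t s)
  have hlam : HasDerivAt (fun τ => cgLam (Function.update t s τ) s j) (cgEps s j) (t s) := by
    convert! ((hts.const_sub 1).const_mul (if idxA N s = j then (1 : ℝ) else 0)).add
      (hts.const_mul (if idxB N s = j then (1 : ℝ) else 0)) using 1
    rw [cgEps]; ring
  have hu : HasDerivAt (fun τ => cgScreen x (Function.update t s τ) s) (cgGap x s) (t s) := by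
    convert! (hts.const_mul (cgGap x s)).const_add (x (idxA N s)) using 1
    ring
  have hne : cgScreen x (Function.update t s (t s)) s - x j ≠ 0 := by
    rw [Function.update_eq_self]
    exact sub_ne_zero.2 (cgScreen_ne_of_mem_openCube hx ht s j)
  have h := (((((hlam.const_mul 2).mul hFj).add ((hlam.pow 2).mul hFs)).const_mul (κ / 2)).add
    ((((hts.const_sub 1).div_const (x (idxA N s) - x j)).add
      (hts.div_const (x (idxB N s) - x j))).const_mul 2)).sub
    ((hasDerivAt_const (t s) (2 : ℝ)).div (hu.sub_const (x j)) hne)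
  simp only [Function.update_eq_self] at h
  convert! h using 1
  have e1 : cgEps s j = cgGap x s * (cgEps s j / cgGap x s) := by field_simp
  have e2 : ∀ A B : ℝ, -1 / A + 1 / B = cgGap x s * ((1 / B - 1 / A) / cgGap x s) := by
    intro A B; rw [mul_div_cancel₀ _ hg]; ring
  rw [cgFieldDeriv, e2]
  generalize cgEps s j / cgGap x s = e at e1 ⊢
  rw [e1]
  simp only [Nat.add_one_sub_one, pow_one, Nat.cast_ofNat, Pi.pow_apply, Function.update_eq_self]
  ring

theorem interpolation_defect {c o u y l : ℝ} (hu : u = l * c + (1 - l) * o) (hc : c - y ≠ 0)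
    (huy : u - y ≠ 0) :
    2 * l / (c - y) - 2 * l ^ 2 / (u - y) = 2 * l * (1 - l) * ((o - y) / ((c - y) * (u - y))) := by
  have : o - y = (u - y) - l * (c - y) + l * (o - y) := by rw [hu]; ring
  field_simp
  rw [hu]; ring

theorem interpolation_endpoints {c o u l : ℝ} (hu : u = l * c + (1 - l) * o) (hco : c ≠ o)
    (hl : 1 - l ≠ 0) :
    -(2 * l ^ 2 / (u - c)) + (2 * l / (c - o) - 2 * l ^ 2 / (u - o)) - 2 * (2 * l / (c - u))
      + 2 * ((1 - l) / (o - c)) - 2 / (u - c) = 0 := by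
  have h0 : o - c ≠ 0 := sub_ne_zero.2 hco.symm
  have h1 : u - c = (1 - l) * (o - c) := by rw [hu]; ring
  have h2 : c - u = -((1 - l) * (o - c)) := by rw [hu]; ring
  have h3 : u - o = -(l * (o - c)) := by rw [hu]; ring
  have h4 : c - o = -(o - c) := by ring
  rw [h1, h2, h3, h4]
  field_simp
  ring

theorem cgForce_inl (κ : ℝ) (x : Fin (2 * N) → ℝ) (t : Fin N → ℝ) (j : Fin (2 * N)) :
    cgForce κ x t (Sum.inl j)
      = 2 / κ * (∑ i, 1 / (x j - x i) - 2 * ∑ r, 1 / (x j - cgScreen x t r)) := by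
  simp only [cgForce, coulombForce, Fintype.sum_sum_type, cgCharge, cgPos, Sum.elim_inl,
    Sum.elim_inr]
  have h : ∑ r, (-2 : ℝ) / (x j - cgScreen x t r)
      = -(2 * ∑ r, 1 / (x j - cgScreen x t r)) := by
    rw [Finset.mul_sum, ← Finset.sum_neg_distrib]
    exact Finset.sum_congr rfl fun r _ => by ring
  rw [h]
  ring

theorem cgForce_inr (κ : ℝ) (x : Fin (2 * N) → ℝ) (t : Fin N → ℝ) (s : Fin N) :
    cgForce κ x t (Sum.inr s)
      = -(4 / κ) * (∑ i, 1 / (cgScreen x t s - x i)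
        - 2 * ∑ r, 1 / (cgScreen x t s - cgScreen x t r)) := by
  simp only [cgForce, coulombForce, Fintype.sum_sum_type, cgCharge, cgPos, Sum.elim_inl,
    Sum.elim_inr, Finset.mul_sum]
  rw [sub_eq_add_neg, ← Finset.sum_neg_distrib, mul_add, mul_add, Finset.mul_sum, Finset.mul_sum,
    Finset.mul_sum, Finset.mul_sum]
  congr 1
  · exact Finset.sum_congr rfl fun r _ => by ring
  · exact Finset.sum_congr rfl fun r _ => by ring

/-- The field in the direction of the screening charge attached to the pair of `x_j`. -/
theorem cgField_pair {κ : ℝ} (hκ : κ ≠ 0) {j o : Fin (2 * N)} {s : Fin N} {l : ℝ}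
    (hx : x ∈ chamber (2 * N)) (ht : t ∈ openCube N) (hjo : j ≠ o)
    (hu : cgScreen x t s = l * x j + (1 - l) * x o) (hl : l ≠ 0) (hl' : 1 - l ≠ 0)
    (hlam : cgLam t s j = l)
    (hend : (1 - t s) / (x (idxA N s) - x j) + t s / (x (idxB N s) - x j)
      = (1 - l) / (x o - x j)) :
    cgField κ j x t s = 2 * l * (1 - l) *
      (∑ i ∈ Finset.univ \ {j, o}, (x o - x i) / ((x j - x i) * (cgScreen x t s - x i))
        - 2 * ∑ r ∈ Finset.univ \ {s}, (x o - cgScreen x t r)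
            / ((x j - cgScreen x t r) * (cgScreen x t s - cgScreen x t r))) := by
  have hF : κ / 2 * (2 * l * cgForce κ x t (Sum.inl j) + l ^ 2 * cgForce κ x t (Sum.inr s))
      = ∑ i, (2 * l / (x j - x i) - 2 * l ^ 2 / (cgScreen x t s - x i))
        - 2 * ∑ r, (2 * l / (x j - cgScreen x t r)
            - 2 * l ^ 2 / (cgScreen x t s - cgScreen x t r)) := by
    have e : ∀ a b : ℝ, a / b = a * (1 / b) := fun a b => by ring
    simp only [fun b => e (2 * l) b, fun b => e (2 * l ^ 2) b, Finset.sum_sub_distrib,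
      ← Finset.mul_sum]
    rw [cgForce_inl, cgForce_inr]
    field_simp
    ring
  have hs1 : ∑ i, (2 * l / (x j - x i) - 2 * l ^ 2 / (cgScreen x t s - x i))
      = 2 * l * (1 - l) * ∑ i ∈ Finset.univ \ {j, o},
          (x o - x i) / ((x j - x i) * (cgScreen x t s - x i))
        + (-(2 * l ^ 2 / (cgScreen x t s - x j))
          + (2 * l / (x j - x o) - 2 * l ^ 2 / (cgScreen x t s - x o))) := by
    rw [← Finset.sum_sdiff (Finset.subset_univ {j, o}), Finset.sum_pair hjo, Finset.mul_sum]
    congr 1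
    · refine Finset.sum_congr rfl fun i hi => ?_
      simp only [Finset.mem_sdiff, Finset.mem_insert, Finset.mem_singleton, not_or] at hi
      exact interpolation_defect hu (sub_ne_zero.2 (hx.injective.ne (Ne.symm hi.2.1)))
        (sub_ne_zero.2 (cgScreen_ne_of_mem_openCube hx ht s i))
    · simp
  have hs2 : ∑ r, (2 * l / (x j - cgScreen x t r)
            - 2 * l ^ 2 / (cgScreen x t s - cgScreen x t r))
      = 2 * l * (1 - l) * ∑ r ∈ Finset.univ \ {s}, (x o - cgScreen x t r)
            / ((x j - cgScreen x t r) * (cgScreen x t s - cgScreen x t r))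
        + 2 * l / (x j - cgScreen x t s) := by
    rw [← Finset.sum_sdiff (Finset.subset_univ {s}), Finset.sum_singleton, Finset.mul_sum]
    congr 1
    · refine Finset.sum_congr rfl fun r hr => ?_
      simp only [Finset.mem_sdiff, Finset.mem_singleton] at hr
      exact interpolation_defect hu
        (sub_ne_zero.2 (cgScreen_ne_of_mem_openCube hx ht r j).symm)
        (sub_ne_zero.2 ((cgScreen_strictMono hx
          (openCube_subset_unitCube ht)).injective.ne (Ne.symm hr.2)))
    · simp
  rw [cgField, hlam, hend, hF, hs1, hs2]
  linear_combination interpolation_endpoints hu (hx.injective.ne hjo) hl'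

theorem cgField_eq {κ : ℝ} (hκ : κ ≠ 0) {j o : Fin (2 * N)} {r : Fin N}
    (hjo : j = idxA N r ∧ o = idxB N r ∨ j = idxB N r ∧ o = idxA N r)
    (hx : x ∈ chamber (2 * N)) (ht : t ∈ openCube N) (s : Fin N) :
    cgField κ j x t s = cgGap x s * (t s * (1 - t s) * cgFactor j o x s t) := by
  have hg := (cgGap_pos hx s).ne'
  have h0 : t s ≠ 0 := (ht s trivial).1.ne'
  have h1 : 1 - t s ≠ 0 := (sub_pos.2 (ht s trivial).2).ne'
  by_cases hs : j = idxA N s ∨ j = idxB N s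
  · rw [cgFactor, if_pos hs]
    have hrs : s = r := by
      rcases hs with h | h <;> rcases hjo with ⟨h', -⟩ | ⟨h', -⟩
      · exact idxA_injective (h.symm.trans h')
      · exact absurd (h.symm.trans h') (idxA_ne_idxB _ _)
      · exact absurd (h'.symm.trans h) (idxA_ne_idxB _ _)
      · exact idxB_injective (h.symm.trans h')
    subst hrs
    rcases hjo with ⟨rfl, rfl⟩ | ⟨rfl, rfl⟩
    · rw [cgField_pair hκ (l := 1 - t s) (o := idxB N s) hx ht (idxA_ne_idxB _ _)
        (by rw [cgScreen, cgGap]; ring) h1 (by simpa using h0)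
        (by simp [cgLam, (idxA_ne_idxB s s).symm]) (by simp)]
      field_simp
      ring
    · rw [cgField_pair hκ (l := t s) (o := idxA N s) hx ht (idxA_ne_idxB _ _).symm
        (by rw [cgScreen, cgGap]; ring) h0 h1
        (by simp [cgLam, idxA_ne_idxB s s]) (by simp)]
      field_simp
  · rw [cgFactor, if_neg hs]
    rw [not_or] at hs
    have hlam : cgLam t s j = 0 := by simp [cgLam, Ne.symm hs.1, Ne.symm hs.2]
    have hA : x (idxA N s) - x j ≠ 0 := sub_ne_zero.2 (hx.injective.ne (Ne.symm hs.1))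
    have hB : x (idxB N s) - x j ≠ 0 := sub_ne_zero.2 (hx.injective.ne (Ne.symm hs.2))
    have hu : cgScreen x t s - x j ≠ 0 :=
      sub_ne_zero.2 (cgScreen_ne_of_mem_openCube hx ht s j)
    rw [cgField, hlam]
    field_simp
    rw [cgScreen, cgGap]
    ring

theorem contDiffAt_cgFactor {j o : Fin (2 * N)} {r : Fin N}
    (hjo : j = idxA N r ∧ o = idxB N r ∨ j = idxB N r ∧ o = idxA N r)
    (hx : x ∈ chamber (2 * N)) (ht : t ∈ unitCube N) (s : Fin N) :
    ContDiffAt ℝ (⊤ : ℕ∞) (cgFactor j o x s) t := by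
  have hc : ∀ r, ContDiffAt ℝ (⊤ : ℕ∞) (fun t => cgScreen x t r) t := fun r => by
    unfold cgScreen; fun_prop
  unfold cgFactor
  split_ifs with hs
  · refine contDiffAt_const.mul (ContDiffAt.sub (ContDiffAt.sum fun i hi => ?_)
      (contDiffAt_const.mul (ContDiffAt.sum fun q hq => ?_)))
    · simp only [Finset.mem_sdiff, Finset.mem_univ, true_and, Finset.mem_insert,
        Finset.mem_singleton, not_or] at hi
      refine contDiffAt_const.div (contDiffAt_const.mul ((hc s).sub contDiffAt_const))
        (mul_ne_zero (sub_ne_zero.2 (hx.injective.ne (Ne.symm hi.1))) (sub_ne_zero.2 ?_))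
      have hrs : s = r := by
        rcases hs with h | h <;> rcases hjo with ⟨h', -⟩ | ⟨h', -⟩
        · exact idxA_injective (h.symm.trans h')
        · exact absurd (h.symm.trans h') (idxA_ne_idxB _ _)
        · exact absurd (h'.symm.trans h) (idxA_ne_idxB _ _)
        · exact idxB_injective (h.symm.trans h')
      subst hrs
      rcases hjo with ⟨rfl, rfl⟩ | ⟨rfl, rfl⟩
      · exact cgScreen_ne hx ht hi.1 hi.2
      · exact cgScreen_ne hx ht hi.2 hi.1
    · simp only [Finset.mem_sdiff, Finset.mem_univ, true_and, Finset.mem_singleton] at hq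
      refine ContDiffAt.div (contDiffAt_const.sub (hc q))
        ((contDiffAt_const.sub (hc q)).mul ((hc s).sub (hc q)))
        (mul_ne_zero (sub_ne_zero.2 (Ne.symm (cgScreen_ne hx ht ?_ ?_)))
          (sub_ne_zero.2 ((cgScreen_strictMono hx ht).injective.ne (Ne.symm hq))))
      · rcases hs with rfl | rfl
        · exact fun h => hq (idxA_injective h.symm)
        · exact (idxA_ne_idxB _ _).symm
      · rcases hs with rfl | rfl
        · exact idxA_ne_idxB _ _
        · exact fun h => hq (idxB_injective h.symm)
  · rw [not_or] at hs
    refine contDiffAt_const.div (contDiffAt_const.mul ((hc s).sub contDiffAt_const)) ?_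
    exact mul_ne_zero (mul_ne_zero (sub_ne_zero.2 (hx.injective.ne (Ne.symm hs.1)))
      (sub_ne_zero.2 (hx.injective.ne (Ne.symm hs.2))))
      (sub_ne_zero.2 (cgScreen_ne hx ht hs.1 hs.2))

end VectorField

section NullVector

variable {N : ℕ} {x : Fin (2 * N) → ℝ} {t : Fin N → ℝ}

theorem exists_forall_ne_cgLam_cgEps (t : Fin N → ℝ) (j : Fin (2 * N)) :
    ∃ r, ∀ s, s ≠ r → cgLam t s j = 0 ∧ cgEps s j = 0 := by
  obtain ⟨r, rfl | rfl⟩ := exists_eq_idx j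
  · exact ⟨r, fun s hs => by
      simp [cgLam, cgEps, idxA_injective.ne hs, (idxA_ne_idxB r s).symm]⟩
  · exact ⟨r, fun s hs => by simp [cgLam, cgEps, idxB_injective.ne hs, idxA_ne_idxB s r]⟩

theorem cgEll_eq (κ : ℝ) (x : Fin (2 * N) → ℝ) (t : Fin N → ℝ) (i : Fin (2 * N)) :
    cgEll κ x t i = cgForce κ x t (Sum.inl i)
      + ∑ s, (cgLam t s i * cgForce κ x t (Sum.inr s) + cgEps s i / cgGap x s) := by
  simp [cgEll, cgVel, Fintype.sum_sum_type, Pi.single_apply, Finset.sum_add_distrib, add_assoc]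

theorem cgEll_sq (κ : ℝ) (x : Fin (2 * N) → ℝ) (t : Fin N → ℝ) (j : Fin (2 * N)) :
    cgEll κ x t j ^ 2 = cgForce κ x t (Sum.inl j) ^ 2
      + ∑ s, (2 * cgForce κ x t (Sum.inl j)
          * (cgLam t s j * cgForce κ x t (Sum.inr s) + cgEps s j / cgGap x s)
        + (cgLam t s j * cgForce κ x t (Sum.inr s) + cgEps s j / cgGap x s) ^ 2) := by
  obtain ⟨r, hr⟩ := exists_forall_ne_cgLam_cgEps t j
  rw [cgEll_eq, Finset.sum_eq_single r, Finset.sum_eq_single r]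
  · ring
  · intro s _ hs
    simp [hr s hs]
  · simp
  · intro s _ hs
    simp [hr s hs]
  · simp

theorem cgEllDeriv_eq (κ : ℝ) (x : Fin (2 * N) → ℝ) (t : Fin N → ℝ) (j : Fin (2 * N)) :
    cgEllDeriv κ x t j = -(∑ β, cgHess κ x t (Sum.inl j) β)
      + ∑ s, (2 * cgLam t s j * cgHess κ x t (Sum.inl j) (Sum.inr s)
        - cgLam t s j ^ 2 * ∑ β, cgHess κ x t (Sum.inr s) β
        - cgEps s j ^ 2 / cgGap x s ^ 2) := by
  have hself : ∀ α, cgHess κ x t α α = 0 := fun α => coulombHess_self _ _ _ _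
  have hcomm : ∀ α β, cgHess κ x t α β = cgHess κ x t β α := fun α β => coulombHess_comm _ _ _ _ _
  have hcross : ∀ s r, cgLam t s j * (cgHess κ x t (Sum.inr s) (Sum.inr r) * cgLam t r j) = 0 := by
    intro s r
    obtain ⟨q, hq⟩ := exists_forall_ne_cgLam_cgEps t j
    by_cases hs : s = q
    · by_cases hr : r = q
      · rw [hs, hr, hself]; ring
      · rw [(hq r hr).1]; ring
    · rw [(hq s hs).1]; ring
  have hrow : ∀ α, ∑ β, cgHess κ x t α β * (cgVel t j β - cgVel t j α)
      = cgHess κ x t α (Sum.inl j) + ∑ r, cgHess κ x t α (Sum.inr r) * cgLam t r j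
        - cgVel t j α * ∑ β, cgHess κ x t α β := by
    intro α
    simp only [mul_sub, Finset.sum_sub_distrib, ← Finset.sum_mul]
    rw [mul_comm (cgVel t j α)]
    congr 1
    simp [Fintype.sum_sum_type, cgVel, Pi.single_apply]
  have hinr : ∀ s, cgLam t s j * (cgHess κ x t (Sum.inr s) (Sum.inl j)
      + ∑ r, cgHess κ x t (Sum.inr s) (Sum.inr r) * cgLam t r j
        - cgLam t s j * ∑ β, cgHess κ x t (Sum.inr s) β)
      = cgLam t s j * cgHess κ x t (Sum.inl j) (Sum.inr s)
        - cgLam t s j ^ 2 * ∑ β, cgHess κ x t (Sum.inr s) β := by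
    intro s
    have : cgLam t s j * ∑ r, cgHess κ x t (Sum.inr s) (Sum.inr r) * cgLam t r j = 0 := by
      rw [Finset.mul_sum]
      exact Finset.sum_eq_zero fun r _ => hcross s r
    rw [hcomm (Sum.inr s) (Sum.inl j)]
    linear_combination this
  have hinl : ∑ i, cgVel t j (Sum.inl i) * (cgHess κ x t (Sum.inl i) (Sum.inl j)
      + ∑ r, cgHess κ x t (Sum.inl i) (Sum.inr r) * cgLam t r j
        - cgVel t j (Sum.inl i) * ∑ β, cgHess κ x t (Sum.inl i) β)
      = ∑ r, cgHess κ x t (Sum.inl j) (Sum.inr r) * cgLam t r j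
        - ∑ β, cgHess κ x t (Sum.inl j) β := by
    rw [Finset.sum_eq_single j]
    · simp [cgVel, hself]
    · intro i _ hi
      simp [cgVel, hi]
    · simp
  have hlam : ∀ s, cgVel t j (Sum.inr s) = cgLam t s j := fun s => rfl
  rw [cgEllDeriv]
  simp only [hrow]
  rw [Fintype.sum_sum_type, hinl]
  simp only [hlam, hinr, Finset.sum_sub_distrib]
  have e1 : ∑ s, cgHess κ x t (Sum.inl j) (Sum.inr s) * cgLam t s j
      = ∑ s, cgLam t s j * cgHess κ x t (Sum.inl j) (Sum.inr s) :=
    Finset.sum_congr rfl fun s _ => mul_comm _ _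
  have e2 : ∑ s, 2 * cgLam t s j * cgHess κ x t (Sum.inl j) (Sum.inr s)
      = 2 * ∑ s, cgLam t s j * cgHess κ x t (Sum.inl j) (Sum.inr s) := by
    rw [Finset.mul_sum]
    exact Finset.sum_congr rfl fun s _ => mul_assoc _ _ _
  rw [e1, e2]
  ring

theorem sum_mul_cgEll (κ : ℝ) (x : Fin (2 * N) → ℝ) (t : Fin N → ℝ) (w : Fin (2 * N) → ℝ) :
    ∑ i, w i * cgEll κ x t i = ∑ i, w i * cgForce κ x t (Sum.inl i)
      + ∑ s, ((w (idxB N s) - w (idxA N s)) / cgGap x s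
        + ((1 - t s) * w (idxA N s) + t s * w (idxB N s)) * cgForce κ x t (Sum.inr s)) := by
  simp only [cgEll_eq, mul_add, Finset.sum_add_distrib, Finset.mul_sum]
  congr 1
  rw [Finset.sum_comm, Finset.sum_comm (s := Finset.univ (α := Fin (2 * N))), add_comm]
  congr 1
  · refine Finset.sum_congr rfl fun s _ => ?_
    have : ∀ i, w i * (cgEps s i / cgGap x s) = (w i * cgEps s i) / cgGap x s := fun i => by ring
    simp only [this, ← Finset.sum_div]
    congr 1
    simp [cgEps, mul_sub, Finset.sum_sub_distrib]
  · refine Finset.sum_congr rfl fun s _ => ?_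
    simp only [← mul_assoc, ← Finset.sum_mul]
    congr 1
    have : ∀ i, w i * cgLam t s i = (if idxA N s = i then (1 - t s) * w i else 0)
        + (if idxB N s = i then t s * w i else 0) := fun i => by
      rw [cgLam]; split_ifs <;> ring
    simp [this, Finset.sum_add_distrib]

/-- The BPZ operator applied to the integrand is a divergence. -/
theorem bpz_eq_divergence {κ : ℝ} (hκ : κ ≠ 0) (hx : x ∈ chamber (2 * N)) (ht : t ∈ openCube N)
    (j : Fin (2 * N)) :
    κ / 2 * (cgEllDeriv κ x t j + cgEll κ x t j ^ 2)
      + ∑ i, (2 / (x i - x j) * cgEll κ x t i - 2 * hexp κ / (x i - x j) ^ 2)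
      = ∑ s, (cgFieldDeriv κ j x t s + cgField κ j x t s * cgForce κ x t (Sum.inr s)) := by
  have hnull := coulomb_null_vector hκ (cgCharge N) (cgPos x t) (cgPos_injective hx ht)
    (j := Sum.inl j) rfl
  generalize hH : ∑ β, coulombHess κ (cgCharge N) (cgPos x t) (Sum.inl j) β = H at hnull
  rw [Fintype.sum_sum_type, ← hH] at hnull
  change κ / 2 * (-(∑ β, cgHess κ x t (Sum.inl j) β) + cgForce κ x t (Sum.inl j) ^ 2)
    + (∑ i, (2 / (x i - x j) * cgForce κ x t (Sum.inl i)
        - 2 * (1 * (1 + 2) / κ - 1 / 2) / (x i - x j) ^ 2)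
      + ∑ s, (2 / (cgScreen x t s - x j) * cgForce κ x t (Sum.inr s)
        - 2 * (-2 * (-2 + 2) / κ - -2 / 2) / (cgScreen x t s - x j) ^ 2)) = 0 at hnull
  have hh : (1 * (1 + 2) / κ - 1 / 2 : ℝ) = hexp κ := by
    rw [hexp]; field_simp; ring
  have h1 : (-2 * (-2 + 2) / κ - -2 / 2 : ℝ) = 1 := by ring
  rw [hh, h1] at hnull
  have hS : ∑ s, (cgFieldDeriv κ j x t s + cgField κ j x t s * cgForce κ x t (Sum.inr s))
      = κ / 2 * (∑ s, (2 * cgLam t s j * cgHess κ x t (Sum.inl j) (Sum.inr s)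
          - cgLam t s j ^ 2 * ∑ β, cgHess κ x t (Sum.inr s) β
          - cgEps s j ^ 2 / cgGap x s ^ 2)
        + ∑ s, (2 * cgForce κ x t (Sum.inl j)
          * (cgLam t s j * cgForce κ x t (Sum.inr s) + cgEps s j / cgGap x s)
        + (cgLam t s j * cgForce κ x t (Sum.inr s) + cgEps s j / cgGap x s) ^ 2))
      + ∑ s, ((2 / (x (idxB N s) - x j) - 2 / (x (idxA N s) - x j)) / cgGap x s
        + ((1 - t s) * (2 / (x (idxA N s) - x j)) + t s * (2 / (x (idxB N s) - x j)))
          * cgForce κ x t (Sum.inr s))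
      - ∑ s, (2 / (cgScreen x t s - x j) * cgForce κ x t (Sum.inr s)
        - 2 * 1 / (cgScreen x t s - x j) ^ 2) := by
    rw [← Finset.sum_add_distrib, Finset.mul_sum, ← Finset.sum_add_distrib,
      ← Finset.sum_sub_distrib]
    refine Finset.sum_congr rfl fun s _ => ?_
    rw [cgFieldDeriv, cgField]
    ring
  have hw := sum_mul_cgEll κ x t (fun i => 2 / (x i - x j))
  rw [hS, cgEllDeriv_eq, cgEll_sq]
  simp only [Finset.sum_sub_distrib] at hnull hw ⊢
  linear_combination hnull + hw

end NullVector

section DivergenceForm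

variable {N : ℕ} {x : Fin (2 * N) → ℝ} {t : Fin N → ℝ}

theorem DifferentiableAt.hasDerivAt_comp_update {ι E : Type*} [Fintype ι] [DecidableEq ι]
    [NormedAddCommGroup E] [NormedSpace ℝ E] {F : (ι → ℝ) → E} {t : ι → ℝ}
    (hF : DifferentiableAt ℝ F t) (s : ι) :
    HasDerivAt (fun τ => F (Function.update t s τ)) (fderiv ℝ F t (Pi.single s 1)) (t s) :=
  hF.hasFDerivAt.comp_hasDerivAt_of_eq (t s) (hasDerivAt_update t s (t s))
    (Function.update_eq_self s t).symm

theorem hasDerivAt_fderivFst {ι E T : Type} [Fintype ι] [DecidableEq ι]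
    [NormedAddCommGroup T] [NormedSpace ℝ T] [NormedAddCommGroup E] [NormedSpace ℝ E]
    {f : (ι → ℝ) × T → E} {x : ι → ℝ} {t : T} (hf : DifferentiableAt ℝ f (x, t)) (i : ι) :
    HasDerivAt (fun τ => f (Function.update x i τ, t)) (fderivFst f (x, t) (Pi.single i 1))
      (x i) := by
  have h : HasFDerivAt (fun y => f (y, t)) (fderivFst f (x, t)) x :=
    hf.hasFDerivAt.comp (f := fun y => (y, t)) x (hasFDerivAt_prodMk_left x t)
  exact h.comp_hasDerivAt_of_eq (x i) (hasDerivAt_update x i (x i))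
    (Function.update_eq_self i x).symm

/-- Partial derivatives of a parametric integral. -/
theorem pd_integral {n : ℕ} {T : Type} [NormedAddCommGroup T] [NormedSpace ℝ T]
    [MeasurableSpace T] [BorelSpace T] {μ : Measure T} [IsFiniteMeasure μ] {K : Set T}
    (hK : IsCompact K) (hμ : μ.restrict K = μ) {S : Set (Fin n → ℝ)} (hS : IsOpen S)
    {f : (Fin n → ℝ) × T → ℝ} (hf : ∀ x ∈ S, ∀ t ∈ K, ContDiffAt ℝ (⊤ : ℕ∞) f (x, t))
    {x : Fin n → ℝ} (hx : x ∈ S) (i : Fin n) :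
    pd n (fun x => ∫ t, f (x, t) ∂μ) i x = ∫ t, fderivFst f (x, t) (Pi.single i 1) ∂μ := by
  have h := hasFDerivAt_integral_of_contDiffAt hK hμ hS hf hx
  have h_int : Integrable (fun t => fderivFst f (x, t)) μ :=
    integrable_of_continuousOn_compact hK hμ fun t ht =>
      ((hf x hx t ht).fderivFst.continuousAt.comp (f := fun t => (x, t))
        (by fun_prop)).continuousWithinAt
  rw [← ContinuousLinearMap.integral_apply h_int]
  exact (h.comp_hasDerivAt_of_eq (x i) (hasDerivAt_update x i (x i))
    (Function.update_eq_self i x).symm).deriv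

theorem fderivFst_cgReg (κ : ℝ) (hx : x ∈ chamber (2 * N)) (ht : t ∈ openCube N)
    (i : Fin (2 * N)) :
    fderivFst (cgReg κ) (x, t) (Pi.single i 1) = cgReg κ (x, t) * cgEll κ x t i :=
  (hasDerivAt_fderivFst ((contDiffAt_cgReg κ hx (openCube_subset_unitCube ht)).differentiableAt
    (by simp)) i).unique (hasDerivAt_cgReg_fst κ hx ht i)

theorem contDiffAt_fderivFst_cgReg (κ : ℝ) (hx : x ∈ chamber (2 * N)) (ht : t ∈ unitCube N)
    (i : Fin (2 * N)) :
    ContDiffAt ℝ (⊤ : ℕ∞) (fun q => fderivFst (cgReg κ) q (Pi.single i 1)) (x, t) :=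
  (contDiffAt_cgReg κ hx ht).fderivFst.clm_apply contDiffAt_const

theorem fderivFst_fderivFst_cgReg (κ : ℝ) (hx : x ∈ chamber (2 * N)) (ht : t ∈ openCube N)
    (j : Fin (2 * N)) :
    fderivFst (fun q => fderivFst (cgReg κ) q (Pi.single j 1)) (x, t) (Pi.single j 1)
      = cgReg κ (x, t) * (cgEllDeriv κ x t j + cgEll κ x t j ^ 2) := by
  have h1 := hasDerivAt_fderivFst ((contDiffAt_fderivFst_cgReg κ hx
    (openCube_subset_unitCube ht) j).differentiableAt (by simp)) j
  have h2 := (hasDerivAt_cgReg_fst κ hx ht j).fun_mul (hasDerivAt_cgEll κ hx ht j)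
  simp only [Function.update_eq_self] at h2
  have h3 := h2.congr_of_eventuallyEq (f₁ := fun τ =>
    fderivFst (cgReg κ) (Function.update x j τ, t) (Pi.single j 1)) (by
      filter_upwards [eventually_update_mem_chamber hx j] with τ hτ
      exact fderivFst_cgReg κ hτ ht j)
  rw [h1.unique h3]
  ring

theorem cgField_divergence {κ : ℝ} (hκ : κ ≠ 0) {j o : Fin (2 * N)} {r : Fin N}
    (hjo : j = idxA N r ∧ o = idxB N r ∨ j = idxB N r ∧ o = idxA N r)
    (hx : x ∈ chamber (2 * N)) (ht : t ∈ openCube N) (s : Fin N) :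
    (1 + -(4 / κ)) * (1 - 2 * t s) * (cgFactor j o x s t * cgReg κ (x, t))
      + t s * (1 - t s)
        * fderiv ℝ (fun t => cgFactor j o x s t * cgReg κ (x, t)) t (Pi.single s 1)
      = cgReg κ (x, t)
        * (cgFieldDeriv κ j x t s + cgField κ j x t s * cgForce κ x t (Sum.inr s)) := by
  have htu := openCube_subset_unitCube ht
  have hg := (cgGap_pos hx s).ne'
  have h0 : t s ≠ 0 := (ht s trivial).1.ne'
  have h1 : 1 - t s ≠ 0 := (sub_pos.2 (ht s trivial).2).ne'
  have hfac := (contDiffAt_cgFactor hjo hx htu s).differentiableAt (by simp)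
  have hreg : DifferentiableAt ℝ (fun t => cgReg κ (x, t)) t :=
    ((contDiffAt_cgReg κ hx htu).differentiableAt (by simp)).comp t (by fun_prop)
  have hM := ((hfac.mul hreg).hasDerivAt_comp_update s)
  have hf := hfac.hasDerivAt_comp_update s
  have hM' := hf.fun_mul (hasDerivAt_cgReg_snd κ hx ht s)
  have hts : HasDerivAt (fun τ => Function.update t s τ s) 1 (t s) := by
    simpa using hasDerivAt_update_apply t s s (t s)
  have hfield := (((hts.fun_mul (hts.const_sub 1)).fun_mul hf).const_mul
    (cgGap x s)).congr_of_eventuallyEq (f₁ := fun τ => cgField κ j x (Function.update t s τ) s) (by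
      filter_upwards [eventually_update_mem_openCube ht s] with τ hτ
      exact cgField_eq hκ hjo hx hτ s)
  have hdiv := mul_left_cancel₀ hg ((hasDerivAt_cgField κ j hx ht s).unique hfield)
  have hMeq := hM.unique hM'
  simp only [Function.update_eq_self] at hMeq hdiv
  change fderiv ℝ (fun t => cgFactor j o x s t * cgReg κ (x, t)) t (Pi.single s 1) = _ at hMeq
  rw [hMeq, hdiv, cgField_eq hκ hjo hx ht s]
  field_simp
  ring

theorem integral_divergence_eq_zero {κ : ℝ} (hκ : 4 < κ) (hx : x ∈ chamber (2 * N))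
    (j : Fin (2 * N)) :
    ∫ t, cgReg κ (x, t) * ∑ s, (cgFieldDeriv κ j x t s
      + cgField κ j x t s * cgForce κ x t (Sum.inr s)) ∂betaMeasure N (-(4 / κ)) = 0 := by
  have hκ0 : κ ≠ 0 := by linarith
  have hp : -1 < -(4 / κ) := by
    rw [neg_lt_neg_iff, div_lt_one (by linarith)]; exact hκ
  have := isFiniteMeasure_betaMeasure (N := N) hp
  obtain ⟨r, o, hjo⟩ : ∃ r o, j = idxA N r ∧ o = idxB N r ∨ j = idxB N r ∧ o = idxA N r := by
    obtain ⟨r, h | h⟩ := exists_eq_idx j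
    · exact ⟨r, _, Or.inl ⟨h, rfl⟩⟩
    · exact ⟨r, _, Or.inr ⟨h, rfl⟩⟩
  have hM : ∀ s, ∀ t ∈ unitCube N,
      ContDiffAt ℝ (⊤ : ℕ∞) (fun t => cgFactor j o x s t * cgReg κ (x, t)) t := fun s t ht =>
    (contDiffAt_cgFactor hjo hx ht s).mul ((contDiffAt_cgReg κ hx ht).comp t (by fun_prop))
  have h_int : ∀ s, Integrable (fun t =>
      (1 + -(4 / κ)) * (1 - 2 * t s) * (cgFactor j o x s t * cgReg κ (x, t))
      + t s * (1 - t s)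
        * fderiv ℝ (fun t => cgFactor j o x s t * cgReg κ (x, t)) t (Pi.single s 1))
      (betaMeasure N (-(4 / κ))) := by
    refine fun s => integrable_of_continuousOn_compact isCompact_unitCube
      (betaMeasure_restrict_unitCube _) fun t ht => ContinuousAt.continuousWithinAt ?_
    have h1 := (hM s t ht).continuousAt
    have h2 := (((hM s t ht).fderiv_right (m := (⊤ : ℕ∞)) le_rfl).clm_apply
      (contDiffAt_const (c := (Pi.single s 1 : Fin N → ℝ)))).continuousAt
    have h3 : ContinuousAt (fun t : Fin N → ℝ => t s) t := (continuous_apply s).continuousAt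
    exact ((continuousAt_const.mul (continuousAt_const.sub (continuousAt_const.mul h3))).mul
      h1).add ((h3.mul (continuousAt_const.sub h3)).mul h2)
  rw [← Finset.sum_eq_zero fun s (_ : s ∈ Finset.univ) =>
    betaMeasure_integral_by_parts hp s (hM s), ← integral_finsetSum _ fun s _ => h_int s]
  refine integral_congr_ae ?_
  filter_upwards [ae_betaMeasure_mem_openCube (-(4 / κ))] with t ht
  rw [Finset.mul_sum]
  exact Finset.sum_congr rfl fun s _ => (cgField_divergence hκ0 hjo hx ht s).symm

theorem pd_congr {n : ℕ} {F G : (Fin n → ℝ) → ℝ} {S : Set (Fin n → ℝ)} (hS : IsOpen S)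
    (h : Set.EqOn F G S) {x : Fin n → ℝ} (hx : x ∈ S) (i : Fin n) : pd n F i x = pd n G i x := by
  have hc : ContinuousAt (fun τ => Function.update x i τ) (x i) :=
    (hasDerivAt_update x i (x i)).continuousAt
  refine EventuallyEq.deriv_eq ?_
  filter_upwards [hc.eventually_mem (hS.mem_nhds (by rwa [Function.update_eq_self]))] with τ hτ
  exact h hτ

end DivergenceForm

/-- `G^{(N)}` is smooth on `𝔛_{2N}` and satisfies the BPZ PDEs. -/
theorem cg_smooth_and_BPZ (κ : ℝ) (hκ₁ : 4 < κ) (hκ₂ : κ < 8) (N : ℕ) (hN : 1 ≤ N) :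
    ContDiffOn ℝ (⊤ : ℕ∞) (cgG κ N) (chamber (2 * N)) ∧
      ∀ j : Fin (2 * N), ∀ x ∈ chamber (2 * N),
        κ / 2 * pd (2 * N) (pd (2 * N) (cgG κ N) j) j x
            + ∑ i ∈ Finset.univ.erase j,
                (2 / (x i - x j) * pd (2 * N) (cgG κ N) i x
                  - 2 * hexp κ / (x i - x j) ^ 2 * cgG κ N x) = 0 := by
  have hp : -1 < -(4 / κ) := by
    rw [neg_lt_neg_iff, div_lt_one (by linarith)]; exact hκ₁
  set μ := betaMeasure N (-(4 / κ)) with hμ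
  have : IsFiniteMeasure μ := isFiniteMeasure_betaMeasure hp
  have hμK : μ.restrict (unitCube N) = μ := betaMeasure_restrict_unitCube _
  have hopen := isOpen_chamber (2 * N)
  have hG : Set.EqOn (cgG κ N) (fun x => ∫ t, cgReg κ (x, t) ∂μ) (chamber (2 * N)) :=
    fun x hx => cgG_eq_integral κ hx
  have hR : ∀ x ∈ chamber (2 * N), ∀ t ∈ unitCube N, ContDiffAt ℝ (⊤ : ℕ∞) (cgReg κ) (x, t) :=
    fun x hx t ht => contDiffAt_cgReg κ hx ht
  have hR' := fun i x hx t ht =>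
    contDiffAt_fderivFst_cgReg (N := N) (x := x) (t := t) κ hx ht i
  refine ⟨(contDiffOn_integral_of_contDiffAt isCompact_unitCube hμK hopen hR).congr hG,
    fun j x hx => ?_⟩
  have hpd : ∀ i, Set.EqOn (pd (2 * N) (cgG κ N) i)
      (fun x => ∫ t, fderivFst (cgReg κ) (x, t) (Pi.single i 1) ∂μ) (chamber (2 * N)) :=
    fun i y hy => (pd_congr hopen hG hy i).trans
      (pd_integral isCompact_unitCube hμK hopen hR hy i)
  have hpd2 := (pd_congr hopen (hpd j) hx j).trans
    (pd_integral isCompact_unitCube hμK hopen (hR' j) hx j)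
  have h_int : ∀ {f : (Fin (2 * N) → ℝ) × (Fin N → ℝ) → ℝ},
      (∀ t ∈ unitCube N, ContDiffAt ℝ (⊤ : ℕ∞) f (x, t)) → Integrable (fun t => f (x, t)) μ :=
    fun hf => integrable_of_continuousOn_compact isCompact_unitCube hμK fun t ht =>
      ((hf t ht).continuousAt.comp (f := fun t => (x, t)) (by fun_prop)).continuousWithinAt
  have h_int0 := h_int (hR x hx)
  have h_int1 := fun i => h_int (hR' i x hx)
  have h_int2 := h_int (f := fun q =>
      fderivFst (fun q => fderivFst (cgReg κ) q (Pi.single j 1)) q (Pi.single j 1))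
    fun t ht => (hR' j x hx t ht).fderivFst.clm_apply contDiffAt_const
  have h_intS : ∀ i, Integrable (fun t => 2 / (x i - x j)
      * fderivFst (cgReg κ) (x, t) (Pi.single i 1)
      - 2 * hexp κ / (x i - x j) ^ 2 * cgReg κ (x, t)) μ :=
    fun i => ((h_int1 i).const_mul _).sub (h_int0.const_mul _)
  rw [Finset.sum_erase _ (by simp), hpd2, hG hx]
  simp only [hpd _ hx]
  rw [← integral_divergence_eq_zero hκ₁ hx j, ← integral_const_mul]
  have hsum : ∑ i, (2 / (x i - x j) * ∫ t, fderivFst (cgReg κ) (x, t) (Pi.single i 1) ∂μ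
      - 2 * hexp κ / (x i - x j) ^ 2 * ∫ t, cgReg κ (x, t) ∂μ)
      = ∫ t, ∑ i, (2 / (x i - x j) * fderivFst (cgReg κ) (x, t) (Pi.single i 1)
        - 2 * hexp κ / (x i - x j) ^ 2 * cgReg κ (x, t)) ∂μ := by
    rw [integral_finsetSum _ fun i _ => h_intS i]
    refine Finset.sum_congr rfl fun i _ => ?_
    rw [integral_sub ((h_int1 i).const_mul _) (h_int0.const_mul _), integral_const_mul,
      integral_const_mul]
  rw [hsum, ← integral_add (h_int2.const_mul _) (integrable_finsetSum _ fun i _ => h_intS i)]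
  refine integral_congr_ae ?_
  filter_upwards [ae_betaMeasure_mem_openCube (-(4 / κ))] with t ht
  simp only [fderivFst_fderivFst_cgReg κ hx ht, fderivFst_cgReg κ hx ht]
  rw [← bpz_eq_divergence (by linarith) hx ht j, mul_add (cgReg κ (x, t)) (κ / 2 * _),
    Finset.mul_sum]
  congr 1
  · ring
  · exact Finset.sum_congr rfl fun i _ => by ring
end
end

section
/- Fix κ ∈ (4,8) and N ≥ 1. Let φ(x) = (ax+b)/(cx+d) with a,b,c,d ∈ ℝ and ad−bc > 0, and let x = (x_1,…,x_{2N}) ∈ 𝔛_{2N} be such that c·x_i + d ≠ 0 for all i and φ(x_1) < φ(x_2) < ⋯ < φ(x_{2N}). Then G^{(N)}(x_1,…,x_{2N}) = ∏_{i=1}^{2N} φ'(x_i)^{h(κ)} · G^{(N)}(φ(x_1),…,φ(x_{2N})), where φ'(x_i) = (ad−bc)/(c·x_i+d)² > 0. -/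
open Filter Topology MeasureTheory

noncomputable section

open Polynomial in
/-- The monic polynomial with roots `v j`. -/
def nodePoly {n : ℕ} (v : Fin n → ℝ) : ℝ[X] := ∏ j, (X - C (v j))

open Polynomial in
/-- The derivative of `p / q ^ 2` at `y`. -/
def doubleRes (p q : ℝ[X]) (y : ℝ) : ℝ :=
  (p.derivative.eval y * q.eval y - 2 * p.eval y * q.derivative.eval y) / q.eval y ^ 3

theorem nodePoly_monic {n : ℕ} (v : Fin n → ℝ) : (nodePoly v).Monic :=
  Polynomial.monic_prod_X_sub_C v Finset.univ

theorem nodePoly_natDegree {n : ℕ} (v : Fin n → ℝ) : (nodePoly v).natDegree = n := by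
  simp [nodePoly]

theorem nodePoly_nextCoeff {n : ℕ} (v : Fin n → ℝ) : (nodePoly v).nextCoeff = -∑ j, v j :=
  Polynomial.prod_X_sub_C_nextCoeff v

theorem nodePoly_eval {n : ℕ} (v : Fin n → ℝ) (y : ℝ) :
    (nodePoly v).eval y = ∏ j, (y - v j) := by
  simp [nodePoly, Polynomial.eval_prod]

open Polynomial in
theorem X_sub_C_sq_dvd_of_eval {p : ℝ[X]} {y : ℝ} (h₀ : p.eval y = 0)
    (h₁ : p.derivative.eval y = 0) : (X - C y) ^ 2 ∣ p := by
  rcases eq_or_ne p 0 with rfl | hp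
  · exact dvd_zero _
  · exact (le_rootMultiplicity_iff hp).1 ((one_lt_rootMultiplicity_iff_isRoot hp).2 ⟨h₀, h₁⟩)

open Polynomial in
/-- The sum of the residues of `p / ∏ (z - u r) ^ 2` at the points `u r`. -/
theorem sum_doubleRes {n : ℕ} (u : Fin (n + 1) → ℝ) (hu : Function.Injective u) (p : ℝ[X])
    (hp : p.Monic) (hdeg : p.natDegree = 2 * (n + 1)) :
    ∑ r, doubleRes p (nodePoly fun j => u (r.succAbove j)) (u r)
      = p.nextCoeff - 2 * (nodePoly u).nextCoeff := by
  set q : Fin (n + 1) → ℝ[X] := fun r => nodePoly fun j => u (r.succAbove j) with hq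
  have hq0 : ∀ r, (q r).eval (u r) ≠ 0 := fun r => by
    rw [hq, nodePoly_eval, Finset.prod_ne_zero_iff]
    exact fun j _ => sub_ne_zero.2 fun h => (Fin.succAbove_ne r j) (hu h).symm
  have hqm : ∀ r, (q r ^ 2).Monic := fun r => (nodePoly_monic _).pow 2
  have hqd : ∀ r, (q r ^ 2).natDegree = 2 * n := fun r => by
    rw [(nodePoly_monic _).natDegree_pow, nodePoly_natDegree]
  set L : Fin (n + 1) → ℝ[X] := fun r =>
    C (doubleRes p (q r) (u r)) * X +
      C (p.eval (u r) / (q r).eval (u r) ^ 2 - doubleRes p (q r) (u r) * u r) with hL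
  set H : ℝ[X] := ∑ r, L r * q r ^ 2 with hH
  have hQm : (nodePoly u ^ 2).Monic := (nodePoly_monic u).pow 2
  have hQd : (nodePoly u ^ 2).natDegree = 2 * (n + 1) := by
    rw [(nodePoly_monic _).natDegree_pow, nodePoly_natDegree]
  have hLd : ∀ r, (L r).natDegree ≤ 1 := fun r => natDegree_linear_le
  have hHd : H.natDegree ≤ 2 * n + 1 := by
    refine natDegree_sum_le_of_forall_le _ _ fun r _ => ?_
    refine natDegree_mul_le.trans ?_
    have := hLd r
    rw [hqd]; omega
  have hdvd : nodePoly u ^ 2 ∣ p - H := by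
    rw [nodePoly, ← Finset.prod_pow]
    refine Finset.prod_dvd_of_coprime (fun r _ s _ hrs => ?_) fun r _ => ?_
    · exact (isCoprime_X_sub_C_of_isUnit_sub
        (sub_ne_zero.2 fun h => hrs (hu h)).isUnit).pow
    · have hsplit : p - H = (p - L r * q r ^ 2) - ∑ s ∈ Finset.univ.erase r, L s * q s ^ 2 := by
        rw [hH, ← Finset.add_sum_erase _ _ (Finset.mem_univ r)]; ring
      rw [hsplit]
      refine dvd_sub (X_sub_C_sq_dvd_of_eval ?_ ?_) (Finset.dvd_sum fun s hs => ?_)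
      · have := hq0 r
        simp only [hL, eval_sub, eval_mul, eval_add, eval_C, eval_X, eval_pow]
        field_simp
        ring
      · have := hq0 r
        simp only [hL, doubleRes, derivative_sub, derivative_mul, derivative_add, derivative_C,
          derivative_X, derivative_pow, eval_sub, eval_mul, eval_add, eval_C, eval_X, eval_pow,
          eval_zero, eval_one]
        push_cast
        field_simp
        ring
      · obtain ⟨j, hj⟩ := Fin.exists_succAbove_eq (Finset.ne_of_mem_erase hs).symm
        refine Dvd.dvd.mul_left (pow_dvd_pow_of_dvd ?_ 2) _
        rw [← hj]
        exact Finset.dvd_prod_of_mem (fun j => X - C (u (s.succAbove j))) (Finset.mem_univ j)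
  have hzero : p - H - nodePoly u ^ 2 = 0 := by
    refine eq_zero_of_dvd_of_degree_lt (dvd_sub hdvd dvd_rfl) ?_
    have h1 : (p - nodePoly u ^ 2).degree < (nodePoly u ^ 2).degree := by
      have hpQ : p.degree = (nodePoly u ^ 2).degree := by
        rw [degree_eq_natDegree hp.ne_zero, degree_eq_natDegree hQm.ne_zero, hdeg, hQd]
      rw [← hpQ]
      exact degree_sub_lt_left hpQ hp.ne_zero (by rw [hp.leadingCoeff, hQm.leadingCoeff])
    have h2 : H.degree < (nodePoly u ^ 2).degree := by
      rw [degree_eq_natDegree hQm.ne_zero, hQd]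
      exact degree_le_natDegree.trans_lt (by exact_mod_cast (by omega))
    have : p - H - nodePoly u ^ 2 = (p - nodePoly u ^ 2) - H := by ring
    rw [this]
    exact (degree_sub_le _ _).trans_lt (max_lt h1 h2)
  have hcoeff := congrArg (fun f => f.coeff (2 * n + 1)) hzero
  have hpc : p.nextCoeff = p.coeff (2 * n + 1) := by
    rw [nextCoeff_of_natDegree_pos (by omega), hdeg]; rfl
  have hQc : (nodePoly u ^ 2).coeff (2 * n + 1) = 2 * (nodePoly u).nextCoeff := by
    have := (nodePoly_monic u).nextCoeff_pow 2
    rw [nextCoeff_of_natDegree_pos (by omega), hQd] at this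
    rw [nsmul_eq_mul] at this
    exact_mod_cast this
  have hHc : H.coeff (2 * n + 1) = ∑ r, doubleRes p (q r) (u r) := by
    rw [hH, finsetSum_coeff]
    refine Finset.sum_congr rfl fun r _ => ?_
    have h1 : (q r ^ 2).coeff (2 * n) = 1 := by
      have := (hqm r).coeff_natDegree
      rwa [hqd] at this
    have h2 : (q r ^ 2).coeff (2 * n + 1) = 0 :=
      coeff_eq_zero_of_natDegree_lt (by rw [hqd]; omega)
    rw [hL]
    simp only [add_mul, mul_assoc, coeff_add, coeff_C_mul, coeff_X_mul, h1, h2]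
    ring
  simp only [coeff_sub, coeff_zero] at hcoeff
  rw [hpc, ← hQc, ← hHc]
  linarith

theorem integrableOn_Ioo_abs_rpow_mul_abs_rpow {a b s : ℝ} (hab : a < b) (hs : -1 < s)
    (hs0 : s ≤ 0) : IntegrableOn (fun u => |u - a| ^ s * |u - b| ^ s) (Set.Ioo a b) := by
  have h1 : IntegrableOn (fun u => (u - a) ^ s) (Set.Ioo a b) := by
    have := (intervalIntegral.intervalIntegrable_rpow' (a := 0) (b := b - a) hs).comp_sub_right a
    rw [zero_add, sub_add_cancel] at this
    exact ((intervalIntegrable_iff_integrableOn_Ioc_of_le hab.le).1 this).mono_set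
      Set.Ioo_subset_Ioc_self
  have h2 : IntegrableOn (fun u => (b - u) ^ s) (Set.Ioo a b) := by
    have := (intervalIntegral.intervalIntegrable_rpow' (a := b - a) (b := 0) hs).comp_sub_left b
    rw [sub_sub_cancel, sub_zero] at this
    exact ((intervalIntegrable_iff_integrableOn_Ioc_of_le hab.le).1 this).mono_set
      Set.Ioo_subset_Ioc_self
  refine Integrable.mono' ((h1.add h2).const_mul (((b - a) / 2) ^ s)) ?_ ?_
  · refine Measurable.aestronglyMeasurable ?_
    fun_prop
  · refine (ae_restrict_iff' measurableSet_Ioo).2 (Eventually.of_forall fun u hu => ?_)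
    have hua : 0 < u - a := sub_pos.2 hu.1
    have hub : 0 < b - u := sub_pos.2 hu.2
    have e1 : |u - a| = u - a := abs_of_pos hua
    have e2 : |u - b| = b - u := by rw [abs_sub_comm, abs_of_pos hub]
    rw [e1, e2, Real.norm_of_nonneg (by positivity)]
    simp only [Pi.add_apply]
    have p1 := Real.rpow_pos_of_pos hua s
    have p2 := Real.rpow_pos_of_pos hub s
    have hm : 0 < (b - a) / 2 := by linarith
    have p3 := Real.rpow_pos_of_pos hm s
    rcases le_total (u - a) (b - u) with h | h
    · have : (b - u) ^ s ≤ ((b - a) / 2) ^ s :=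
        Real.rpow_le_rpow_of_nonpos hm (by linarith) hs0
      nlinarith
    · have : (u - a) ^ s ≤ ((b - a) / 2) ^ s :=
        Real.rpow_le_rpow_of_nonpos hm (by linarith) hs0
      nlinarith

theorem setIntegral_pi_Ioo_eq_zero_of_hasDerivAt {n : ℕ} {a b : Fin (n + 1) → ℝ}
    (hab : ∀ r, a r ≤ b r) (r : Fin (n + 1)) (F : (Fin (n + 1) → ℝ) → ℝ)
    (H : (Fin n → ℝ) → ℝ → ℝ)
    (hcont : ∀ v ∈ Set.univ.pi fun j => Set.Ioo (a (r.succAbove j)) (b (r.succAbove j)),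
      ContinuousOn (H v) (Set.Icc (a r) (b r)))
    (hderiv : ∀ v ∈ Set.univ.pi fun j => Set.Ioo (a (r.succAbove j)) (b (r.succAbove j)),
      ∀ y ∈ Set.Ioo (a r) (b r), HasDerivAt (H v) (F (r.insertNth y v)) y)
    (hbd : ∀ v, H v (a r) = H v (b r)) :
    ∫ u in Set.univ.pi fun j => Set.Ioo (a j) (b j), F u = 0 := by
  set V := Set.univ.pi fun j => Set.Ioo (a (r.succAbove j)) (b (r.succAbove j)) with hV
  have hVm : MeasurableSet V := MeasurableSet.univ_pi fun _ => measurableSet_Ioo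
  set e := MeasurableEquiv.piFinSuccAbove (fun _ => ℝ) r
  have he : ∀ z : ℝ × (Fin n → ℝ), e.symm z = r.insertNth z.1 z.2 := fun z => rfl
  have hpre : e.symm ⁻¹' (Set.univ.pi fun j => Set.Ioo (a j) (b j))
      = Set.Ioo (a r) (b r) ×ˢ V := by
    ext z
    simp only [Set.mem_preimage, he, Set.mem_univ_pi, Set.mem_prod, hV]
    rw [Fin.forall_iff_succAbove r]
    simp
  rw [← (volume_preserving_piFinSuccAbove (fun _ => ℝ) r).symm.setIntegral_preimage_emb
    e.symm.measurableEmbedding, hpre, Measure.volume_eq_prod, ← setIntegral_prod_swap]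
  by_cases hint : IntegrableOn (fun z : (Fin n → ℝ) × ℝ => F (e.symm z.swap))
      (V ×ˢ Set.Ioo (a r) (b r)) (volume.prod volume)
  · rw [setIntegral_prod _ hint]
    refine setIntegral_eq_zero_of_forall_eq_zero fun v hv => ?_
    by_cases hi : IntegrableOn (fun y => F (e.symm (y, v))) (Set.Ioo (a r) (b r))
    · have := intervalIntegral.integral_eq_sub_of_hasDerivAt_of_le (hab r) (hcont v hv)
        (hderiv v hv) ((intervalIntegrable_iff_integrableOn_Ioo_of_le (hab r)).2 hi)
      rw [hbd, sub_self, intervalIntegral.integral_of_le (hab r),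
        integral_Ioc_eq_integral_Ioo] at this
      exact this
    · exact integral_undef hi
  · exact integral_undef hint

/-- The closure of the box `cgBox`. -/
def cgClosedBox (N : ℕ) (x : Fin (2 * N) → ℝ) : Set (Fin N → ℝ) :=
  Set.univ.pi fun r => Set.Icc (x (idxA N r)) (x (idxB N r))

theorem isCompact_cgClosedBox (N : ℕ) (x : Fin (2 * N) → ℝ) : IsCompact (cgClosedBox N x) :=
  isCompact_univ_pi fun _ => isCompact_Icc

theorem measurableSet_cgBox (N : ℕ) (x : Fin (2 * N) → ℝ) : MeasurableSet (cgBox N x) :=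
  MeasurableSet.univ_pi fun _ => measurableSet_Ioo

theorem cgBox_subset_cgClosedBox (N : ℕ) (x : Fin (2 * N) → ℝ) :
    cgBox N x ⊆ cgClosedBox N x :=
  Set.pi_mono fun _ _ => Set.Ioo_subset_Icc_self

theorem idxA_lt_idxB (N : ℕ) (r : Fin N) : idxA N r < idxB N r := by
  simp [idxA, idxB, Fin.lt_def]

theorem idxB_lt_idxA {N : ℕ} {r s : Fin N} (h : r < s) : idxB N r < idxA N s := by
  simp only [idxA, idxB, Fin.lt_def] at *
  omega

theorem le_idxA_or_idxB_le (N : ℕ) (r : Fin N) (i : Fin (2 * N)) :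
    i ≤ idxA N r ∨ idxB N r ≤ i := by
  simp only [idxA, idxB, Fin.le_def]
  omega

section ClosedBox

variable {N : ℕ} {x : Fin (2 * N) → ℝ} {u : Fin N → ℝ}

theorem strictMono_of_mem_cgClosedBox (hx : StrictMono x) (hu : u ∈ cgClosedBox N x) :
    StrictMono u := fun r s h =>
  (hu r trivial).2.trans_lt ((hx (idxB_lt_idxA h)).trans_le (hu s trivial).1)

theorem ne_of_mem_cgBox (hx : StrictMono x) (hu : u ∈ cgBox N x) (r : Fin N)
    (i : Fin (2 * N)) : u r ≠ x i := by
  have := hu r trivial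
  rcases le_idxA_or_idxB_le N r i with h | h
  · exact ((hx.monotone h).trans_lt this.1).ne'
  · exact (this.2.trans_le (hx.monotone h)).ne

theorem ne_of_mem_cgClosedBox (hx : StrictMono x) (hu : u ∈ cgClosedBox N x) {r : Fin N}
    {i : Fin (2 * N)} (hA : i ≠ idxA N r) (hB : i ≠ idxB N r) : u r ≠ x i := by
  have := hu r trivial
  rcases le_idxA_or_idxB_le N r i with h | h
  · exact ((hx (lt_of_le_of_ne h hA)).trans_le this.1).ne'
  · exact (this.2.trans_lt (hx (lt_of_le_of_ne h hB.symm))).ne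

end ClosedBox

theorem integrableOn_mul_cgIntegrand {κ : ℝ} (hκ : 4 < κ) {N : ℕ} {x : Fin (2 * N) → ℝ}
    (hx : StrictMono x) {g : (Fin N → ℝ) → ℝ} (hg : ContinuousOn g (cgClosedBox N x)) :
    IntegrableOn (fun u => g u * cgIntegrand κ N x u) (cgBox N x) := by
  have hκ0 : 0 < κ := by linarith
  have hβ : -1 < -(4 / κ) := by
    rw [neg_lt_neg_iff, div_lt_one hκ0]; exact hκ
  have hβ0 : -(4 / κ) ≤ 0 := by
    rw [neg_nonpos]; positivity
  set S : (Fin N → ℝ) → ℝ := fun u => ∏ r : Fin N,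
    |u r - x (idxA N r)| ^ (-(4 / κ)) * |u r - x (idxB N r)| ^ (-(4 / κ)) with hS
  set B : (Fin N → ℝ) → ℝ := fun u =>
    (∏ r : Fin N, ∏ s : Fin N, if r < s then (u s - u r) ^ (8 / κ) else 1) *
      ∏ r : Fin N, ∏ i : Fin (2 * N),
        if i = idxA N r ∨ i = idxB N r then 1 else |u r - x i| ^ (-(4 / κ)) with hB
  have hfac : ∀ u, cgIntegrand κ N x u = B u * S u := fun u => by
    simp only [cgIntegrand, hB, hS]
    rw [mul_assoc]
    refine congrArg₂ (· * ·) rfl ((Finset.prod_congr rfl fun r _ => ?_).trans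
      Finset.prod_mul_distrib)
    have h1 : ∏ i ∈ {idxA N r, idxB N r},
        (if i = idxA N r ∨ i = idxB N r then 1 else |u r - x i| ^ (-(4 / κ))) = 1 :=
      Finset.prod_eq_one fun i hi => if_pos (by simpa using hi)
    have h2 : ∏ i ∈ {idxA N r, idxB N r}ᶜ,
        (if i = idxA N r ∨ i = idxB N r then 1 else |u r - x i| ^ (-(4 / κ)))
          = ∏ i ∈ {idxA N r, idxB N r}ᶜ, |u r - x i| ^ (-(4 / κ)) :=
      Finset.prod_congr rfl fun i hi => if_neg (by simpa using hi)
    rw [← Finset.prod_mul_prod_compl {idxA N r, idxB N r} (fun i => |u r - x i| ^ (-(4 / κ))),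
      ← Finset.prod_mul_prod_compl {idxA N r, idxB N r}
        (fun i => if i = idxA N r ∨ i = idxB N r then 1 else |u r - x i| ^ (-(4 / κ))),
      h1, h2, one_mul, Finset.prod_pair (idxA_lt_idxB N r).ne, mul_comm]
  have hBc : ContinuousOn B (cgClosedBox N x) := by
    refine ContinuousOn.mul ?_ ?_
    · refine continuousOn_finsetProd _ fun r _ => continuousOn_finsetProd _ fun s _ => ?_
      by_cases h : r < s
      · simp only [if_pos h]
        exact ContinuousOn.rpow_const (by fun_prop) fun u hu =>
          Or.inl (sub_pos.2 (strictMono_of_mem_cgClosedBox hx hu h)).ne'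
      · simp only [if_neg h]; fun_prop
    · refine continuousOn_finsetProd _ fun r _ => continuousOn_finsetProd _ fun i _ => ?_
      by_cases h : i = idxA N r ∨ i = idxB N r
      · simp only [if_pos h]; fun_prop
      · simp only [if_neg h]
        push Not at h
        exact ContinuousOn.rpow_const (by fun_prop) fun u hu =>
          Or.inl (abs_pos.2 (sub_ne_zero.2 (ne_of_mem_cgClosedBox hx hu h.1 h.2))).ne'
  have hSi : IntegrableOn S (cgBox N x) := by
    rw [IntegrableOn, cgBox, volume_pi, Measure.restrict_pi_pi]
    exact Integrable.fintype_prod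
      (f := fun r y => |y - x (idxA N r)| ^ (-(4 / κ)) * |y - x (idxB N r)| ^ (-(4 / κ)))
      fun r => integrableOn_Ioo_abs_rpow_mul_abs_rpow (hx (idxA_lt_idxB N r)) hβ hβ0
  have := IntegrableOn.continuousOn_mul_of_subset (hg.mul hBc) hSi (isCompact_cgClosedBox N x)
    (measurableSet_cgBox N x) (cgBox_subset_cgClosedBox N x)
  refine this.congr_fun (fun u _ => ?_) (measurableSet_cgBox N x)
  simp only [hfac, Pi.mul_apply, mul_assoc]

theorem continuous_mul_abs_rpow {s : ℝ} (hs : -1 < s) : Continuous fun y : ℝ => y * |y| ^ s := by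
  have h : (fun y : ℝ => y * |y| ^ s) = fun y => (max y 0) ^ (1 + s) - (max (-y) 0) ^ (1 + s) := by
    have h1 : (1 + s) ≠ 0 := by linarith
    ext y
    rcases lt_trichotomy y 0 with hy | rfl | hy
    · rw [max_eq_right hy.le, max_eq_left (by linarith), Real.zero_rpow h1, abs_of_neg hy,
        Real.rpow_add (by linarith), Real.rpow_one]
      ring
    · simp [h1]
    · rw [max_eq_left hy.le, max_eq_right (by linarith), Real.zero_rpow h1, abs_of_pos hy,
        Real.rpow_add hy, Real.rpow_one]
      ring
  rw [h]
  exact ((continuous_id.max continuous_const).rpow_const fun _ => Or.inr (by linarith)).sub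
    ((continuous_neg.max continuous_const).rpow_const fun _ => Or.inr (by linarith))

theorem hasDerivAt_mul_abs_rpow (s : ℝ) {y : ℝ} (hy : y ≠ 0) :
    HasDerivAt (fun y : ℝ => y * |y| ^ s) ((1 + s) * |y| ^ s) y := by
  have hy' := abs_pos.2 hy
  have h := (hasDerivAt_id y).mul ((hasDerivAt_abs hy).rpow_const (p := s) (Or.inl hy'.ne'))
  refine h.congr_deriv ?_
  have hs : y * (SignType.sign y : ℝ) = |y| := by rw [mul_comm]; exact sign_mul_self y
  have hp : |y| ^ s = |y| * |y| ^ (s - 1) := by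
    rw [Real.rpow_sub_one hy'.ne']; field_simp
  simp only [id]
  rw [hp]
  linear_combination (s * |y| ^ (s - 1)) * hs

theorem hasDerivAt_eval_div_eval_sq (p q : Polynomial ℝ) {y : ℝ} (hq : q.eval y ≠ 0) :
    HasDerivAt (fun y => p.eval y / q.eval y ^ 2) (doubleRes p q y) y := by
  refine ((p.hasDerivAt y).div ((q.hasDerivAt y).pow 2) (pow_ne_zero 2 hq)).congr_deriv ?_
  simp only [doubleRes, Pi.pow_apply]
  field_simp
  ring

/-- The factor of `cgIntegrand` which does not involve the removed variable. -/
def cgRemainder (κ : ℝ) {n m : ℕ} (x : Fin m → ℝ) (v : Fin n → ℝ) : ℝ :=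
  (∏ j : Fin n, ∏ k : Fin n, if j < k then |v k - v j| ^ (8 / κ) else 1) *
    ∏ j : Fin n, ∏ i : Fin m, |v j - x i| ^ (-(4 / κ))

theorem cgIntegrand_eq_abs_rpow_mul (κ : ℝ) {n : ℕ} (x : Fin (2 * (n + 1)) → ℝ)
    {u : Fin (n + 1) → ℝ} (hu : StrictMono u) (r : Fin (n + 1)) :
    cgIntegrand κ (n + 1) x u
      = |(nodePoly x).eval (u r) / (nodePoly fun j => u (r.succAbove j)).eval (u r) ^ 2|
          ^ (-(4 / κ)) * cgRemainder κ x (fun j => u (r.succAbove j)) := by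
  have habs : ∀ s t : Fin (n + 1), (if s < t then (u t - u s) ^ (8 / κ) else 1)
      = if s < t then |u t - u s| ^ (8 / κ) else 1 := fun s t => by
    split_ifs with h
    · rw [abs_of_pos (sub_pos.2 (hu h))]
    · rfl
  have hpair : ∀ j : Fin n, (if r < r.succAbove j then
        |u (r.succAbove j) - u r| ^ (8 / κ) else 1) *
      (if r.succAbove j < r then |u r - u (r.succAbove j)| ^ (8 / κ) else 1)
      = (|u r - u (r.succAbove j)| ^ 2) ^ (4 / κ) := fun j => by
    have e : (|u r - u (r.succAbove j)| ^ 2) ^ (4 / κ) = |u r - u (r.succAbove j)| ^ (8 / κ) := by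
      rw [← Real.rpow_natCast, ← Real.rpow_mul (abs_nonneg _)]
      congr 1; push_cast; ring
    rw [e]
    rcases lt_or_gt_of_ne (Fin.succAbove_ne r j) with h | h
    · rw [if_neg h.le.not_gt, if_pos h, one_mul]
    · rw [if_neg h.le.not_gt, if_pos h, mul_one, abs_sub_comm]
  have hP : ∏ i, |u r - x i| ^ (-(4 / κ)) = |(nodePoly x).eval (u r)| ^ (-(4 / κ)) := by
    rw [nodePoly_eval, Finset.abs_prod]
    exact Real.finsetProd_rpow _ _ (fun i _ => abs_nonneg _) _
  have hq : ∏ j : Fin n, (|u r - u (r.succAbove j)| ^ 2) ^ (4 / κ)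
      = (|(nodePoly fun j => u (r.succAbove j)).eval (u r)| ^ 2) ^ (4 / κ) := by
    rw [nodePoly_eval, Finset.abs_prod, ← Finset.prod_pow]
    exact Real.finsetProd_rpow _ _ (fun i _ => by positivity) _
  rw [cgIntegrand, cgRemainder, abs_div, abs_pow, Real.div_rpow (abs_nonneg _) (by positivity),
    Real.rpow_neg (by positivity : (0 : ℝ) ≤ _ ^ 2), div_inv_eq_mul, ← hP, ← hq]
  simp only [habs, Fin.prod_univ_succAbove _ r, lt_self_iff_false, if_false, one_mul,
    Finset.prod_mul_distrib, Fin.succAbove_lt_succAbove_iff, ← hpair]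
  ring

theorem continuousOn_doubleRes {n : ℕ} (p : Polynomial ℝ) (r : Fin (n + 1))
    {K : Set (Fin (n + 1) → ℝ)} (hK : ∀ u ∈ K, Function.Injective u) :
    ContinuousOn (fun u : Fin (n + 1) → ℝ =>
      doubleRes p (nodePoly fun j => u (r.succAbove j)) (u r)) K := by
  have hq : Continuous fun u : Fin (n + 1) → ℝ =>
      (nodePoly fun j => u (r.succAbove j)).eval (u r) := by
    simp only [nodePoly_eval]
    fun_prop
  have hq' : Continuous fun u : Fin (n + 1) → ℝ =>
      (nodePoly fun j => u (r.succAbove j)).derivative.eval (u r) := by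
    simp only [nodePoly, Polynomial.derivative_prod_finset, Polynomial.eval_finsetSum,
      Polynomial.eval_mul, Polynomial.eval_prod, Polynomial.eval_sub, Polynomial.eval_X,
      Polynomial.eval_C, Polynomial.derivative_X_sub_C, Polynomial.eval_one]
    fun_prop
  have hp : Continuous fun u : Fin (n + 1) → ℝ => p.eval (u r) :=
    p.continuous.comp (continuous_apply r)
  have hp' : Continuous fun u : Fin (n + 1) → ℝ => p.derivative.eval (u r) :=
    p.derivative.continuous.comp (continuous_apply r)
  refine ContinuousOn.div ?_ (hq.pow 3).continuousOn fun u hu => pow_ne_zero 3 ?_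
  · exact ((hp'.mul hq).sub ((continuous_const.mul hp).mul hq')).continuousOn
  · rw [nodePoly_eval, Finset.prod_ne_zero_iff]
    exact fun j _ => sub_ne_zero.2 fun h => (Fin.succAbove_ne r j) (hK u hu h).symm

theorem setIntegral_doubleRes_mul_cgIntegrand {κ : ℝ} (hκ : 4 < κ) {n : ℕ}
    {x : Fin (2 * (n + 1)) → ℝ} (hx : StrictMono x) (r : Fin (n + 1)) :
    ∫ u in cgBox (n + 1) x, doubleRes (nodePoly x) (nodePoly fun j => u (r.succAbove j)) (u r)
      * cgIntegrand κ (n + 1) x u = 0 := by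
  have hκ0 : 0 < κ := by linarith
  have hβ : -1 < -(4 / κ) := by
    rw [neg_lt_neg_iff, div_lt_one hκ0]; exact hκ
  set g : (Fin n → ℝ) → ℝ → ℝ := fun v y =>
    (nodePoly x).eval y / (nodePoly v).eval y ^ 2 with hg
  have hroot : ∀ v i, g v (x i) = 0 := fun v i => by
    simp only [hg]
    rw [nodePoly_eval, Finset.prod_eq_zero (Finset.mem_univ i) (sub_self _), zero_div]
  have hq0 : ∀ v : Fin n → ℝ, ∀ y, StrictMono (r.insertNth y v : Fin (n + 1) → ℝ) →
      (nodePoly v).eval y ≠ 0 := fun v y hu => by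
    rw [nodePoly_eval, Finset.prod_ne_zero_iff]
    intro j _
    have := hu.injective.ne (Fin.succAbove_ne r j).symm
    simpa [sub_eq_zero] using this
  refine setIntegral_pi_Ioo_eq_zero_of_hasDerivAt
    (fun s => (hx (idxA_lt_idxB (n + 1) s)).le) r _
    (fun v y => (1 + -(4 / κ))⁻¹ * (g v y * |g v y| ^ (-(4 / κ))) * cgRemainder κ x v)
    (fun v hv => ?_) (fun v hv y hy => ?_) fun v => ?_
  · have hmono : ∀ y ∈ Set.Icc (x (idxA (n + 1) r)) (x (idxB (n + 1) r)),
        StrictMono (r.insertNth y v : Fin (n + 1) → ℝ) := fun y hy => by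
      refine strictMono_of_mem_cgClosedBox hx fun s _ => ?_
      revert s
      rw [Fin.forall_iff_succAbove r]
      exact ⟨fun _ => by simpa using hy, fun j _ => by
        simpa using Set.Ioo_subset_Icc_self (hv j trivial)⟩
    have hgc : ContinuousOn (g v) (Set.Icc (x (idxA (n + 1) r)) (x (idxB (n + 1) r))) :=
      (nodePoly x).continuous.continuousOn.div ((nodePoly v).continuous.pow 2).continuousOn
        fun y hy => pow_ne_zero 2 (hq0 v y (hmono y hy))
    exact (((continuous_mul_abs_rpow hβ).comp_continuousOn hgc).const_mul _).mul
      continuousOn_const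
  · have hmem : (r.insertNth y v : Fin (n + 1) → ℝ) ∈ cgBox (n + 1) x := fun s _ => by
      revert s
      rw [Fin.forall_iff_succAbove r]
      exact ⟨by simpa using hy, fun j => by simpa using hv j trivial⟩
    have hmono := strictMono_of_mem_cgClosedBox hx (cgBox_subset_cgClosedBox _ _ hmem)
    have hgy : g v y ≠ 0 := by
      refine div_ne_zero ?_ (pow_ne_zero 2 (hq0 v y hmono))
      rw [nodePoly_eval, Finset.prod_ne_zero_iff]
      intro i _
      simpa [sub_eq_zero] using ne_of_mem_cgBox hx hmem r i
    have hd := (((hasDerivAt_mul_abs_rpow (-(4 / κ)) hgy).comp y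
      (hasDerivAt_eval_div_eval_sq (nodePoly x) (nodePoly v) (hq0 v y hmono))).const_mul
        (1 + -(4 / κ))⁻¹).mul_const (cgRemainder κ x v)
    refine hd.congr_deriv ?_
    rw [cgIntegrand_eq_abs_rpow_mul κ x hmono r]
    simp only [Fin.insertNth_apply_same, Fin.insertNth_apply_succAbove]
    have : (1 + -(4 / κ)) ≠ 0 := by linarith
    rw [mul_assoc (1 + -(4 / κ)), inv_mul_cancel_left₀ this]
    simp only [hg]
    ring
  · simp [hroot]

/-- The total derivative identity behind special conformal covariance. -/
theorem setIntegral_sum_sub_sum_mul_cgIntegrand {κ : ℝ} (hκ : 4 < κ) {N : ℕ} (hN : 1 ≤ N)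
    {x : Fin (2 * N) → ℝ} (hx : StrictMono x) :
    ∫ u in cgBox N x, (2 * ∑ r, u r - ∑ i, x i) * cgIntegrand κ N x u = 0 := by
  obtain ⟨n, rfl⟩ := Nat.exists_eq_add_of_le' hN
  have hsum : ∀ u ∈ cgBox (n + 1) x, (2 * ∑ r, u r - ∑ i, x i) * cgIntegrand κ (n + 1) x u
      = ∑ r, doubleRes (nodePoly x) (nodePoly fun j => u (r.succAbove j)) (u r)
        * cgIntegrand κ (n + 1) x u := fun u hu => by
    have hmono := strictMono_of_mem_cgClosedBox hx (cgBox_subset_cgClosedBox _ _ hu)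
    rw [← Finset.sum_mul, sum_doubleRes u hmono.injective _ (nodePoly_monic x)
      (nodePoly_natDegree x), nodePoly_nextCoeff, nodePoly_nextCoeff]
    ring
  rw [setIntegral_congr_fun (measurableSet_cgBox _ _) hsum, integral_finsetSum]
  · exact Finset.sum_eq_zero fun r _ => setIntegral_doubleRes_mul_cgIntegrand hκ hx r
  · exact fun r _ => integrableOn_mul_cgIntegrand hκ hx (continuousOn_doubleRes _ r
      fun u hu => (strictMono_of_mem_cgClosedBox hx hu).injective)

theorem prod_prod_lt_mul {M : Type*} [CommMonoid M] {n : ℕ} (g : Fin n → M) :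
    (∏ i, ∏ k, if i < k then g i * g k else 1) = ∏ i, g i ^ (n - 1) := by
  have h : ∀ i k, (if i < k then g i * g k else 1)
      = (if i < k then g i else 1) * (if i < k then g k else 1) := fun i k => by
    split_ifs <;> simp
  simp only [h, Finset.prod_mul_distrib]
  rw [Finset.prod_comm (f := fun i k => if i < k then g k else 1), ← Finset.prod_mul_distrib]
  refine Finset.prod_congr rfl fun i _ => ?_
  rw [← Finset.prod_filter, ← Finset.prod_filter, Finset.prod_const, Finset.prod_const,
    ← pow_add]
  congr 1
  rw [Finset.filter_lt_eq_Ioi, Finset.filter_gt_eq_Iio, Fin.card_Ioi, Fin.card_Iio]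
  omega

theorem affine_pos_of_mem_Icc {c d p q v : ℝ} (hp : 0 < c * p + d) (hq : 0 < c * q + d)
    (hv : v ∈ Set.Icc p q) : 0 < c * v + d := by
  rcases le_total 0 c with hc | hc
  · have := mul_le_mul_of_nonneg_left hv.1 hc
    linarith
  · have := mul_le_mul_of_nonpos_left hv.2 hc
    linarith

section Mobius

variable {a b c d : ℝ}

theorem mobius_sub_mobius (hdet : a * d - b * c = 1) {v w : ℝ} (hv : c * v + d ≠ 0)
    (hw : c * w + d ≠ 0) :
    (a * v + b) / (c * v + d) - (a * w + b) / (c * w + d)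
      = (v - w) / ((c * v + d) * (c * w + d)) := by
  rw [div_sub_div _ _ hv hw]
  congr 1
  linear_combination (v - w) * hdet

theorem hasDerivAt_mobius (hdet : a * d - b * c = 1) {v : ℝ} (hv : c * v + d ≠ 0) :
    HasDerivAt (fun v => (a * v + b) / (c * v + d)) ((c * v + d) ^ 2)⁻¹ v := by
  have h := ((((hasDerivAt_id v).const_mul a).add_const b).div
    (((hasDerivAt_id v).const_mul c).add_const d) hv)
  refine h.congr_deriv ?_
  rw [inv_eq_one_div]
  congr 1
  simp only [id]
  linear_combination hdet

theorem image_mobius_Ioo (hdet : a * d - b * c = 1) {p q : ℝ} (hp : 0 < c * p + d)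
    (hq : 0 < c * q + d) :
    (fun v => (a * v + b) / (c * v + d)) '' Set.Ioo p q
      = Set.Ioo ((a * p + b) / (c * p + d)) ((a * q + b) / (c * q + d)) := by
  ext w
  constructor
  · rintro ⟨v, hv, rfl⟩
    have hm := affine_pos_of_mem_Icc hp hq (Set.Ioo_subset_Icc_self hv)
    constructor
    · rw [← sub_pos, mobius_sub_mobius hdet hm.ne' hp.ne']
      exact div_pos (sub_pos.2 hv.1) (mul_pos hm hp)
    · rw [← sub_pos, mobius_sub_mobius hdet hq.ne' hm.ne']
      exact div_pos (sub_pos.2 hv.2) (mul_pos hq hm)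
  · intro hw
    have hinv : ∀ v, 0 < c * v + d →
        -c * ((a * v + b) / (c * v + d)) + a = (c * v + d)⁻¹ := fun v hv => by
      field_simp
      linear_combination hdet
    have hm : 0 < -c * w + a := affine_pos_of_mem_Icc
      (by rw [hinv p hp]; exact inv_pos.2 hp) (by rw [hinv q hq]; exact inv_pos.2 hq)
      (Set.Ioo_subset_Icc_self hw)
    have hback : ∀ v, 0 < c * v + d →
        (d * ((a * v + b) / (c * v + d)) + -b) / (-c * ((a * v + b) / (c * v + d)) + a) = v :=
      fun v hv => by
        have := div_mul_cancel₀ (a * v + b) hv.ne'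
        rw [hinv v hv, div_inv_eq_mul]
        linear_combination d * this + v * hdet
    have hdet' : d * a - -b * -c = 1 := by linear_combination hdet
    have hpi : 0 < -c * ((a * p + b) / (c * p + d)) + a := by
      rw [hinv p hp]; exact inv_pos.2 hp
    have hqi : 0 < -c * ((a * q + b) / (c * q + d)) + a := by
      rw [hinv q hq]; exact inv_pos.2 hq
    refine ⟨(d * w + -b) / (-c * w + a), ⟨?_, ?_⟩, ?_⟩
    · rw [← sub_pos]
      nth_rewrite 1 [← hback p hp]
      rw [mobius_sub_mobius hdet' hm.ne' hpi.ne']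
      exact div_pos (sub_pos.2 hw.1) (mul_pos hm hpi)
    · rw [← sub_pos]
      nth_rewrite 1 [← hback q hq]
      rw [mobius_sub_mobius hdet' hqi.ne' hm.ne']
      exact div_pos (sub_pos.2 hw.2) (mul_pos hqi hm)
    · have h1 : c * ((d * w + -b) / (-c * w + a)) + d = (-c * w + a)⁻¹ := by
        have h := mul_inv_cancel₀ hm.ne'
        rw [div_eq_mul_inv]
        linear_combination (-c * w + a)⁻¹ * hdet - d * h
      have := div_mul_cancel₀ (d * w + -b) hm.ne'
      simp only
      rw [h1, div_inv_eq_mul]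
      linear_combination a * this + w * hdet

variable {N : ℕ} {x : Fin (2 * N) → ℝ} {u : Fin N → ℝ}

theorem affine_pos_of_mem_cgClosedBox (hm : ∀ i, 0 < c * x i + d) (hu : u ∈ cgClosedBox N x)
    (r : Fin N) : 0 < c * u r + d :=
  affine_pos_of_mem_Icc (hm _) (hm _) (hu r trivial)

theorem cgIntegrand_mobius (κ : ℝ) (hdet : a * d - b * c = 1)
    (hx : StrictMono x) (hm : ∀ i, 0 < c * x i + d) (hu : u ∈ cgBox N x) :
    (∏ r, ((c * u r + d) ^ 2)⁻¹) * cgIntegrand κ N (fun i => (a * x i + b) / (c * x i + d))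
        (fun r => (a * u r + b) / (c * u r + d))
      = (∏ i, (c * x i + d) ^ (4 / κ)) ^ N *
        ((∏ r, (c * u r + d) ^ (8 / κ - 2)) * cgIntegrand κ N x u) := by
  have hu' := cgBox_subset_cgClosedBox _ _ hu
  have hmu := affine_pos_of_mem_cgClosedBox hm hu'
  have hV : ∀ r s : Fin N, (if r < s then ((a * u s + b) / (c * u s + d)
        - (a * u r + b) / (c * u r + d)) ^ (8 / κ) else 1)
      = (if r < s then (u s - u r) ^ (8 / κ) else 1) *
        (if r < s then ((c * u r + d) ^ (8 / κ))⁻¹ * ((c * u s + d) ^ (8 / κ))⁻¹ else 1) :=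
    fun r s => by
      split_ifs with h
      · have h0 := sub_pos.2 (strictMono_of_mem_cgClosedBox hx hu' h)
        rw [mobius_sub_mobius hdet (hmu s).ne' (hmu r).ne', Real.div_rpow h0.le
          (mul_pos (hmu s) (hmu r)).le, Real.mul_rpow (hmu s).le (hmu r).le, div_eq_mul_inv,
          mul_inv_rev]
      · rw [one_mul]
  have hD : ∀ (r : Fin N) (i : Fin (2 * N)), |(a * u r + b) / (c * u r + d)
        - (a * x i + b) / (c * x i + d)| ^ (-(4 / κ))
      = |u r - x i| ^ (-(4 / κ)) * ((c * u r + d) ^ (4 / κ) * (c * x i + d) ^ (4 / κ)) :=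
    fun r i => by
      have h0 := mul_pos (hmu r) (hm i)
      rw [mobius_sub_mobius hdet (hmu r).ne' (hm i).ne', abs_div, abs_of_pos h0,
        Real.div_rpow (abs_nonneg _) h0.le, Real.rpow_neg h0.le, div_inv_eq_mul,
        Real.mul_rpow (hmu r).le (hm i).le]
  simp only [cgIntegrand, hV, hD, Finset.prod_mul_distrib, prod_prod_lt_mul, Finset.prod_const,
    Finset.card_univ, Fintype.card_fin]
  have hpow : (∏ r, ((c * u r + d) ^ 2)⁻¹) * ((∏ r, (((c * u r + d) ^ (8 / κ))⁻¹) ^ (N - 1)) *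
      ∏ r, ((c * u r + d) ^ (4 / κ)) ^ (2 * N)) = ∏ r, (c * u r + d) ^ (8 / κ - 2) := by
    rw [← Finset.prod_mul_distrib, ← Finset.prod_mul_distrib]
    refine Finset.prod_congr rfl fun r _ => ?_
    have h1 : ((c * u r + d) ^ (4 / κ)) ^ (2 * N) = ((c * u r + d) ^ (8 / κ)) ^ N := by
      rw [pow_mul, ← Real.rpow_natCast _ 2, ← Real.rpow_mul (hmu r).le]
      congr 2; push_cast; ring
    have h2 : ((c * u r + d) ^ (8 / κ)) ^ N
        = ((c * u r + d) ^ (8 / κ)) ^ (N - 1) * (c * u r + d) ^ (8 / κ) := by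
      rw [← pow_succ, Nat.sub_add_cancel (by have := r.isLt; omega)]
    have h3 : (c * u r + d) ^ (8 / κ) ≠ 0 := (Real.rpow_pos_of_pos (hmu r) _).ne'
    have h4 : (c * u r + d) ^ (2 : ℝ) = (c * u r + d) ^ 2 := Real.rpow_natCast _ 2
    rw [h1, h2, Real.rpow_sub (hmu r), h4, inv_pow]
    field_simp
  rw [← hpow]
  ring

theorem setIntegral_cgBox_mobius (κ : ℝ) (hdet : a * d - b * c = 1)
    (hx : StrictMono x) (hm : ∀ i, 0 < c * x i + d) (w : (Fin N → ℝ) → ℝ) :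
    ∫ v in cgBox N (fun i => (a * x i + b) / (c * x i + d)),
        w v * cgIntegrand κ N (fun i => (a * x i + b) / (c * x i + d)) v
      = (∏ i, (c * x i + d) ^ (4 / κ)) ^ N *
        ∫ u in cgBox N x, w (fun r => (a * u r + b) / (c * u r + d)) *
          ((∏ r, (c * u r + d) ^ (8 / κ - 2)) * cgIntegrand κ N x u) := by
  set φ : ℝ → ℝ := fun v => (a * v + b) / (c * v + d) with hφ
  have himage : cgBox N (fun i => φ (x i)) = (fun u r => φ (u r)) '' cgBox N x := by
    have := Set.piMap_image_univ_pi (fun _ : Fin N => φ)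
      (fun r => Set.Ioo (x (idxA N r)) (x (idxB N r)))
    rw [cgBox, cgBox]
    simp only [hφ, image_mobius_Ioo hdet (hm _) (hm _)] at this
    exact this.symm
  have hpos : ∀ u ∈ cgBox N x, ∀ r, 0 < c * u r + d := fun u hu =>
    affine_pos_of_mem_cgClosedBox hm (cgBox_subset_cgClosedBox _ _ hu)
  have hderiv : ∀ u ∈ cgBox N x, HasFDerivWithinAt (fun (u : Fin N → ℝ) r => φ (u r))
      (ContinuousLinearMap.pi fun r : Fin N =>
        (ContinuousLinearMap.toSpanSingleton ℝ ((c * u r + d) ^ 2)⁻¹).comp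
          (ContinuousLinearMap.proj r)) (cgBox N x) u := fun u hu => by
    refine HasFDerivAt.hasFDerivWithinAt (hasFDerivAt_pi.2 fun r => ?_)
    exact ((hasDerivAt_mobius hdet (hpos u hu r).ne').hasFDerivAt).comp u
      (ContinuousLinearMap.proj (R := ℝ) (φ := fun _ : Fin N => ℝ) r).hasFDerivAt
  have hinj : Set.InjOn (fun (u : Fin N → ℝ) r => φ (u r)) (cgBox N x) :=
    fun u hu v hv huv => funext fun r => by
      have h := sub_eq_zero.2 (congrFun huv r)
      simp only [hφ] at h
      rw [mobius_sub_mobius hdet (hpos u hu r).ne' (hpos v hv r).ne', div_eq_zero_iff] at h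
      exact sub_eq_zero.1 (h.resolve_right (mul_pos (hpos u hu r) (hpos v hv r)).ne')
  rw [himage, integral_image_eq_integral_abs_det_fderiv_smul volume (measurableSet_cgBox N x)
    hderiv hinj, ← integral_const_mul]
  refine setIntegral_congr_fun (measurableSet_cgBox N x) fun u hu => ?_
  have hdet' : |(ContinuousLinearMap.pi fun r : Fin N =>
        (ContinuousLinearMap.toSpanSingleton ℝ ((c * u r + d) ^ 2)⁻¹).comp
          (ContinuousLinearMap.proj r : (Fin N → ℝ) →L[ℝ] ℝ)).det|
      = ∏ r, ((c * u r + d) ^ 2)⁻¹ := by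
    rw [ContinuousLinearMap.det_pi]
    simp only [ContinuousLinearMap.det_toSpanSingleton]
    exact abs_of_nonneg (Finset.prod_nonneg fun r _ => by positivity)
  have := cgIntegrand_mobius κ hdet hx hm hu
  simp only [hdet', smul_eq_mul]
  rw [mul_left_comm, this]
  ring

theorem prod_prod_mobius_sub_rpow (κ : ℝ) (hdet : a * d - b * c = 1)
    (hx : StrictMono x) (hm : ∀ i, 0 < c * x i + d) :
    (∏ i, ∏ k, if i < k then ((a * x k + b) / (c * x k + d)
        - (a * x i + b) / (c * x i + d)) ^ (2 / κ) else 1)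
      = (∏ i, ∏ k, if i < k then (x k - x i) ^ (2 / κ) else 1) *
        ∏ i, (((c * x i + d) ^ (2 / κ))⁻¹) ^ (2 * N - 1) := by
  rw [← prod_prod_lt_mul, ← Finset.prod_mul_distrib]
  refine Finset.prod_congr rfl fun i _ => ?_
  rw [← Finset.prod_mul_distrib]
  refine Finset.prod_congr rfl fun k _ => ?_
  split_ifs with h
  · rw [mobius_sub_mobius hdet (hm k).ne' (hm i).ne', Real.div_rpow (sub_pos.2 (hx h)).le
      (mul_pos (hm k) (hm i)).le, Real.mul_rpow (hm k).le (hm i).le, div_eq_mul_inv, mul_inv_rev]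
  · rw [one_mul]

theorem setIntegral_affine_ratio_mul_cgIntegrand {κ : ℝ} (hκ : 4 < κ) (hN : 1 ≤ N)
    (hx : StrictMono x) (hm : ∀ i, 0 < c * x i + d) (p q : ℝ) :
    ∫ u in cgBox N x, (2 * ∑ r, (p * u r + q) / (c * u r + d)
        - ∑ i, (p * x i + q) / (c * x i + d)) *
      ((∏ r, (c * u r + d) ^ (8 / κ - 2)) * cgIntegrand κ N x u) = 0 := by
  have hδ : 0 < c ^ 2 + d ^ 2 := by
    have h := hm ⟨0, by omega⟩
    by_contra! hle
    have hc : c = 0 := by nlinarith [sq_nonneg c, sq_nonneg d]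
    have hd : d = 0 := by nlinarith [sq_nonneg c, sq_nonneg d]
    simp [hc, hd] at h
  set δ := c ^ 2 + d ^ 2
  have hdet : d / δ * d - -c / δ * c = 1 := by
    field_simp
    simp only [δ]
    ring
  set φ : ℝ → ℝ := fun v => (d / δ * v + -c / δ) / (c * v + d) with hφ
  have hφx : StrictMono fun i => φ (x i) := fun i j hij => by
    rw [← sub_pos]
    simp only [hφ]
    rw [mobius_sub_mobius hdet (hm j).ne' (hm i).ne']
    exact div_pos (sub_pos.2 (hx hij)) (mul_pos (hm j) (hm i))
  have hδi : c ^ 2 * δ⁻¹ + d ^ 2 * δ⁻¹ = 1 := by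
    rw [← add_mul]
    exact mul_inv_cancel₀ hδ.ne'
  have hsplit : ∀ v, 0 < c * v + d →
      (p * v + q) / (c * v + d) = (p * d - q * c) * φ v + (p * c + q * d) / δ := fun v hv => by
    have hφm : φ v * (c * v + d) = d / δ * v + -c / δ := div_mul_cancel₀ _ hv.ne'
    rw [div_eq_iff hv.ne']
    linear_combination -(p * v + q) * hδi - (p * d - q * c) * hφm
  have key := setIntegral_cgBox_mobius κ hdet hx hm (fun v => 2 * ∑ r, v r - ∑ i, φ (x i))
  rw [setIntegral_sum_sub_sum_mul_cgIntegrand hκ hN hφx] at key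
  have hpos : (∏ i, (c * x i + d) ^ (4 / κ)) ^ N ≠ 0 :=
    pow_ne_zero _ (Finset.prod_ne_zero_iff.2 fun i _ => (Real.rpow_pos_of_pos (hm i) _).ne')
  have key' := (mul_eq_zero.1 key.symm).resolve_left hpos
  rw [← mul_zero (p * d - q * c), ← key', ← integral_const_mul]
  refine setIntegral_congr_fun (measurableSet_cgBox N x) fun u hu => ?_
  have hmu := affine_pos_of_mem_cgClosedBox hm (cgBox_subset_cgClosedBox _ _ hu)
  simp only [hsplit _ (hm _), hsplit _ (hmu _), Finset.sum_add_distrib, ← Finset.mul_sum,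
    Finset.sum_const, Finset.card_univ, Fintype.card_fin, nsmul_eq_mul]
  push_cast
  ring

end Mobius

theorem hasDerivAt_prod_of_logDeriv {ι : Type*} (s : Finset ι) {f : ι → ℝ → ℝ} {l : ι → ℝ}
    {t : ℝ} (h : ∀ i, HasDerivAt (f i) (f i t * l i) t) :
    HasDerivAt (fun t => ∏ i ∈ s, f i t) ((∏ i ∈ s, f i t) * ∑ i ∈ s, l i) t := by
  classical
  induction s using Finset.induction_on with
  | empty => simpa using hasDerivAt_const t (1 : ℝ)
  | insert i s hi ih =>
    simp only [Finset.prod_insert hi, Finset.sum_insert hi]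
    exact ((h i).mul ih).congr_deriv (by ring)

theorem hasDerivAt_prod_affine_rpow {ι : Type*} (s : Finset ι) (c d e : ℝ) (v : ι → ℝ) {t : ℝ}
    (h : ∀ i, 0 < t * c * v i + (1 + t * (d - 1))) :
    HasDerivAt (fun t => ∏ i ∈ s, (t * c * v i + (1 + t * (d - 1))) ^ e)
      ((∏ i ∈ s, (t * c * v i + (1 + t * (d - 1))) ^ e) *
        (e * ∑ i ∈ s, (c * v i + (d - 1)) / (t * c * v i + (1 + t * (d - 1))))) t := by
  rw [Finset.mul_sum]
  refine hasDerivAt_prod_of_logDeriv s fun i => ?_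
  have h1 : HasDerivAt (fun t => t * c * v i + (1 + t * (d - 1))) (c * v i + (d - 1)) t := by
    have := (((hasDerivAt_id t).mul_const c).mul_const (v i)).add
      (((hasDerivAt_id t).mul_const (d - 1)).const_add 1)
    exact this.congr_deriv (by ring)
  refine (h1.rpow_const (p := e) (Or.inl (h i).ne')).congr_deriv ?_
  rw [Real.rpow_sub_one (h i).ne']
  ring

theorem continuousOn_prod_rpow {ι X : Type*} [Fintype ι] [TopologicalSpace X] {S : Set X}
    {m : ι → X → ℝ} (e : ℝ) (hc : ∀ i, Continuous (m i)) (hm : ∀ i, ∀ y ∈ S, 0 < m i y) :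
    ContinuousOn (fun y => ∏ i, m i y ^ e) S :=
  continuousOn_finsetProd _ fun i _ =>
    (hc i).continuousOn.rpow_const fun y hy => Or.inl (hm i y hy).ne'

theorem continuousOn_sum_div {ι X : Type*} [Fintype ι] [TopologicalSpace X] {S : Set X}
    {n m : ι → X → ℝ} (hn : ∀ i, Continuous (n i)) (hc : ∀ i, Continuous (m i))
    (hm : ∀ i, ∀ y ∈ S, 0 < m i y) : ContinuousOn (fun y => ∑ i, n i y / m i y) S :=
  continuousOn_finsetSum _ fun i _ =>
    (hn i).continuousOn.div (hc i).continuousOn fun y hy => (hm i y hy).ne'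

theorem setIntegral_prod_rpow_mul_cgIntegrand {κ : ℝ} (hκ : 4 < κ) {N : ℕ} (hN : 1 ≤ N)
    {x : Fin (2 * N) → ℝ} (hx : StrictMono x) {c d : ℝ} (hm : ∀ i, 0 < c * x i + d) :
    ∫ u in cgBox N x, (∏ r, (c * u r + d) ^ (8 / κ - 2)) * cgIntegrand κ N x u
      = (∏ i, (c * x i + d) ^ (4 / κ - 1)) * ∫ u in cgBox N x, cgIntegrand κ N x u := by
  set m : ℝ → ℝ → ℝ := fun t v => t * c * v + (1 + t * (d - 1)) with hm_def
  set P : (Fin N → ℝ) → ℝ → ℝ := fun u t => ∏ r, m t (u r) ^ (8 / κ - 2) with hP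
  set Q : ℝ → ℝ := fun t => ∏ i, m t (x i) ^ (1 - 4 / κ) with hQ
  set L : (Fin N → ℝ) → ℝ → ℝ := fun u t =>
    2 * ∑ r, (c * u r + (d - 1)) / m t (u r) - ∑ i, (c * x i + (d - 1)) / m t (x i) with hL
  have hpos : ∀ t ∈ Set.Icc (0 : ℝ) 1, ∀ v, 0 < c * v + d → 0 < m t v := fun t ht v hv => by
    have h : m t v = (1 - t) + t * (c * v + d) := by simp only [hm_def]; ring
    rw [h]
    rcases ht.1.eq_or_lt with rfl | h0
    · norm_num
    · have := mul_pos h0 hv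
      linarith [ht.2]
  have hposx : ∀ t ∈ Set.Icc (0 : ℝ) 1, ∀ i, 0 < m t (x i) := fun t ht i => hpos t ht _ (hm i)
  have hposu : ∀ t ∈ Set.Icc (0 : ℝ) 1, ∀ u ∈ cgClosedBox N x, ∀ r, 0 < m t (u r) :=
    fun t ht u hu r => hpos t ht _ (affine_pos_of_mem_cgClosedBox hm hu r)
  have hderiv : ∀ u ∈ cgClosedBox N x, ∀ t ∈ Set.Icc (0 : ℝ) 1,
      HasDerivAt (fun t => P u t * Q t) (-(1 - 4 / κ) * Q t * (L u t * P u t)) t :=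
    fun u hu t ht => by
      refine ((hasDerivAt_prod_affine_rpow Finset.univ c d (8 / κ - 2) u (hposu t ht u hu)).mul
        (hasDerivAt_prod_affine_rpow Finset.univ c d (1 - 4 / κ) x (hposx t ht))).congr_deriv ?_
      simp only [hL, hP, hQ, hm_def]
      ring
  have hcont : ContinuousOn (fun z : ℝ × (Fin N → ℝ) =>
      -(1 - 4 / κ) * Q z.1 * (L z.2 z.1 * P z.2 z.1)) (Set.Icc 0 1 ×ˢ cgClosedBox N x) := by
    have hu : ∀ r, ∀ z ∈ (Set.Icc (0 : ℝ) 1 ×ˢ cgClosedBox N x), 0 < m z.1 (z.2 r) :=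
      fun r z hz => hposu _ hz.1 _ hz.2 r
    have hx' : ∀ i, ∀ z ∈ (Set.Icc (0 : ℝ) 1 ×ˢ cgClosedBox N x), 0 < m z.1 (x i) :=
      fun i z hz => hposx _ hz.1 i
    have hmu : ∀ r, Continuous fun z : ℝ × (Fin N → ℝ) => m z.1 (z.2 r) := fun r => by
      simp only [hm_def]; fun_prop
    have hmx : ∀ i, Continuous fun z : ℝ × (Fin N → ℝ) => m z.1 (x i) := fun i => by
      simp only [hm_def]; fun_prop
    refine (continuousOn_const.mul (continuousOn_prod_rpow _ hmx hx')).mul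
      (((continuousOn_const.mul (continuousOn_sum_div (fun r => ?_) hmu hu)).sub
        (continuousOn_sum_div (fun i => ?_) hmx hx')).mul (continuousOn_prod_rpow _ hmu hu))
    · fun_prop
    · fun_prop
  have hf : IntegrableOn (cgIntegrand κ N x) (cgBox N x) := by
    simpa using integrableOn_mul_cgIntegrand hκ hx (g := fun _ => 1) continuousOn_const
  have hint : Integrable (fun z : ℝ × (Fin N → ℝ) =>
      (-(1 - 4 / κ) * Q z.1 * (L z.2 z.1 * P z.2 z.1)) * cgIntegrand κ N x z.2)
      ((volume.restrict (Set.Ioc (0 : ℝ) 1)).prod (volume.restrict (cgBox N x))) := by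
    have h := hf.comp_snd (volume.restrict (Set.Ioc (0 : ℝ) 1))
    rw [Measure.prod_restrict] at h ⊢
    exact IntegrableOn.continuousOn_mul_of_subset hcont h
      (isCompact_Icc.prod (isCompact_cgClosedBox N x))
      (measurableSet_Ioc.prod (measurableSet_cgBox N x))
      (Set.prod_mono Set.Ioc_subset_Icc_self (cgBox_subset_cgClosedBox N x))
  have hPi : ∀ t ∈ Set.Icc (0 : ℝ) 1,
      IntegrableOn (fun u => P u t * Q t * cgIntegrand κ N x u) (cgBox N x) := fun t ht => by
    refine integrableOn_mul_cgIntegrand hκ hx ?_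
    refine ContinuousOn.mul (continuousOn_prod_rpow _ (fun r => ?_) fun r u hu =>
      hposu t ht u hu r) continuousOn_const
    simp only [hm_def]; fun_prop
  have h0 : (0 : ℝ) ∈ Set.Icc (0 : ℝ) 1 := by simp
  have h1 : (1 : ℝ) ∈ Set.Icc (0 : ℝ) 1 := by simp
  have hFTC : ∀ u ∈ cgBox N x, P u 1 * Q 1 * cgIntegrand κ N x u - P u 0 * Q 0 * cgIntegrand κ N x u
      = ∫ t in Set.Ioc (0 : ℝ) 1,
        (-(1 - 4 / κ) * Q t * (L u t * P u t)) * cgIntegrand κ N x u := fun u hu => by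
    have hu' := cgBox_subset_cgClosedBox _ _ hu
    rw [integral_mul_const, ← intervalIntegral.integral_of_le zero_le_one,
      intervalIntegral.integral_eq_sub_of_hasDerivAt (f := fun t => P u t * Q t), sub_mul]
    · exact fun t ht => hderiv u hu' t (by rwa [Set.uIcc_of_le zero_le_one] at ht)
    · refine ContinuousOn.intervalIntegrable ?_
      rw [Set.uIcc_of_le zero_le_one]
      exact ContinuousOn.comp (f := fun t : ℝ => (t, u)) hcont (by fun_prop)
        fun t ht => Set.mk_mem_prod ht hu'
  have hzero : ∀ t ∈ Set.Ioc (0 : ℝ) 1, ∫ u in cgBox N x,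
      (-(1 - 4 / κ) * Q t * (L u t * P u t)) * cgIntegrand κ N x u = 0 := fun t ht => by
    have h := setIntegral_affine_ratio_mul_cgIntegrand hκ hN hx (c := t * c)
      (d := 1 + t * (d - 1)) (hposx t (Set.Ioc_subset_Icc_self ht)) c (d - 1)
    rw [← mul_zero (-(1 - 4 / κ) * Q t), ← h, ← integral_const_mul]
    refine integral_congr_ae (Eventually.of_forall fun u => ?_)
    simp only [hL, hP, hm_def]
    ring
  have hconst : ∫ u in cgBox N x, P u 1 * Q 1 * cgIntegrand κ N x u
      = ∫ u in cgBox N x, P u 0 * Q 0 * cgIntegrand κ N x u := by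
    rw [← sub_eq_zero, ← integral_sub (hPi 1 h1) (hPi 0 h0),
      setIntegral_congr_fun (measurableSet_cgBox N x) hFTC, ← integral_integral_swap hint,
      setIntegral_congr_fun measurableSet_Ioc hzero, integral_zero]
  have e0 : ∀ v, m 0 v = 1 := fun v => by simp [hm_def]
  have e1 : ∀ v, m 1 v = c * v + d := fun v => by simp [hm_def]
  simp only [hP, hQ, e0, e1, Real.one_rpow, Finset.prod_const_one, one_mul] at hconst
  rw [← hconst, ← integral_const_mul]
  refine integral_congr_ae (Eventually.of_forall fun u => ?_)
  have hQQ : (∏ i, (c * x i + d) ^ (4 / κ - 1)) * (∏ i, (c * x i + d) ^ (1 - 4 / κ)) = 1 := by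
    rw [← Finset.prod_mul_distrib]
    refine Finset.prod_eq_one fun i _ => ?_
    rw [← Real.rpow_add (hm i)]
    simp
  simp only
  linear_combination (-(∏ r, (c * u r + d) ^ (8 / κ - 2)) * cgIntegrand κ N x u) * hQQ

theorem cgG_mobius_of_pos {κ : ℝ} (hκ : 4 < κ) {N : ℕ} (hN : 1 ≤ N) {a b c d : ℝ}
    (hdet : a * d - b * c = 1) {x : Fin (2 * N) → ℝ} (hx : StrictMono x)
    (hm : ∀ i, 0 < c * x i + d) :
    cgG κ N x = (∏ i, (1 / (c * x i + d) ^ 2) ^ hexp κ)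
      * cgG κ N (fun i => (a * x i + b) / (c * x i + d)) := by
  have h := setIntegral_cgBox_mobius κ hdet hx hm fun _ => 1
  simp only [one_mul] at h
  rw [cgG, cgG, h, prod_prod_mobius_sub_rpow κ hdet hx hm,
    setIntegral_prod_rpow_mul_cgIntegrand hκ hN hx hm]
  have hexponents : (∏ i, (1 / (c * x i + d) ^ 2) ^ hexp κ) *
      (∏ i, (((c * x i + d) ^ (2 / κ))⁻¹) ^ (2 * N - 1)) *
      (∏ i, (c * x i + d) ^ (4 / κ)) ^ N * (∏ i, (c * x i + d) ^ (4 / κ - 1)) = 1 := by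
    rw [← Finset.prod_pow, ← Finset.prod_mul_distrib, ← Finset.prod_mul_distrib,
      ← Finset.prod_mul_distrib]
    refine Finset.prod_eq_one fun i _ => ?_
    have hi := hm i
    rw [one_div, ← Real.rpow_natCast _ 2, ← Real.rpow_neg hi.le, ← Real.rpow_neg hi.le,
      ← Real.rpow_mul hi.le, ← Real.rpow_mul_natCast hi.le, ← Real.rpow_mul_natCast hi.le,
      ← Real.rpow_add hi, ← Real.rpow_add hi, ← Real.rpow_add hi]
    convert Real.rpow_zero _ using 2
    rw [Nat.cast_sub (by omega), hexp]
    push_cast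
    field_simp
    ring
  linear_combination (-(cgConst κ ^ N * (∏ i, ∏ k, if i < k then (x k - x i) ^ (2 / κ) else 1) *
    ∫ u in cgBox N x, cgIntegrand κ N x u)) * hexponents

/-- Möbius covariance of `G^{(N)}` with conformal weight `h(κ)`. -/
theorem cg_mobius_covariance (κ : ℝ) (hκ₁ : 4 < κ) (hκ₂ : κ < 8) (N : ℕ) (hN : 1 ≤ N)
    (a b c d : ℝ) (hdet : a * d - b * c > 0)
    (x : Fin (2 * N) → ℝ) (hx : StrictMono x)
    (hden : ∀ i, c * x i + d ≠ 0)
    (hmono : StrictMono fun i => (a * x i + b) / (c * x i + d)) :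
    cgG κ N x
      = (∏ i : Fin (2 * N), ((a * d - b * c) / (c * x i + d) ^ 2) ^ hexp κ)
          * cgG κ N (fun i => (a * x i + b) / (c * x i + d)) := by
  have hsign : ∀ i, 0 < (c * x ⟨0, by omega⟩ + d) * (c * x i + d) := fun i => by
    rcases eq_or_ne i ⟨0, by omega⟩ with rfl | hi
    · exact mul_self_pos.2 (hden _)
    · have hlt : (⟨0, by omega⟩ : Fin (2 * N)) < i :=
        lt_of_le_of_ne (Fin.mk_le_of_le_val (Nat.zero_le _)) hi.symm
      have h := sub_pos.2 (hmono hlt)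
      simp only at h
      rw [div_sub_div _ _ (hden i) (hden _)] at h
      have hnum : 0 < (a * x i + b) * (c * x ⟨0, by omega⟩ + d)
          - (c * x i + d) * (a * x ⟨0, by omega⟩ + b) := by
        have := mul_pos hdet (sub_pos.2 (hx hlt))
        linarith
      rw [mul_comm]
      exact (div_pos_iff_of_pos_left hnum).1 h
  obtain ⟨δ, hδ, hm⟩ : ∃ δ : ℝ, δ ^ 2 = a * d - b * c ∧ ∀ i, 0 < c / δ * x i + d / δ := by
    have hs := Real.sqrt_pos.2 hdet
    have hmul : ∀ δ : ℝ, 0 < δ * (c * x ⟨0, by omega⟩ + d) →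
        ∀ i, 0 < c / δ * x i + d / δ := fun δ h i => by
      have e : c / δ * x i + d / δ = (c * x i + d) / δ := by ring
      rw [e]
      rcases pos_and_pos_or_neg_and_neg_of_mul_pos h with ⟨h1, h2⟩ | ⟨h1, h2⟩
      · exact div_pos ((mul_pos_iff_of_pos_left h2).1 (hsign i)) h1
      · exact div_pos_of_neg_of_neg (neg_of_mul_pos_right (hsign i) h2.le) h1
    rcases (hden ⟨0, by omega⟩).lt_or_gt with h | h
    · exact ⟨-√(a * d - b * c), by rw [neg_sq, Real.sq_sqrt hdet.le],
        hmul _ (mul_pos_of_neg_of_neg (neg_neg_of_pos hs) h)⟩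
    · exact ⟨√(a * d - b * c), Real.sq_sqrt hdet.le, hmul _ (mul_pos hs h)⟩
  have hδ0 : δ ≠ 0 := fun h => by
    rw [h] at hδ
    linarith
  have hdet1 : a / δ * (d / δ) - b / δ * (c / δ) = 1 := by
    rw [div_mul_div_comm, div_mul_div_comm, ← sub_div, ← hδ, ← pow_two,
      div_self (pow_ne_zero 2 hδ0)]
  have hnorm : ∀ p q v : ℝ, p / δ * v + q / δ = (p * v + q) / δ := fun p q v => by ring
  have key := cgG_mobius_of_pos hκ₁ hN hdet1 hx hm
  simp only [hnorm, div_div_div_cancel_right₀ hδ0, div_pow, hδ, one_div_div] at key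
  exact key
end
end
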